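/- arXiv:1912.06345 — 2 statements merged into one kernel-verified Lean document; each statement's English description precedes it below -/
import Mathlib

section
/- For every integer n ≥ 1, the complex number i·∫ Σ_{j=1}^{3n} A_j(n)·( 1/(5+x)^{j+1} + 1/(5−x)^{j+1} ) dx, the integral taken along the straight-line segment from −1−2i to −1+2i, is a rational number, and 2^{−⌊5n/2⌋+1}·L_n times this number is an integer. -/
open scoped Classical

/-- `A j n`: the Laurent coefficient of `(x+5)^{-(j+1)}` of `R_n` at `x = -5`, i.e.
`(1/(3n-j)!) (d/dx)^{3n-j} [(x+5)^{3n+1} R_n(x)]` at `x = -5`, where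
`(x+5)^{3n+1} R_n(x) = 5 x^{2n} (x⁴+6x²+25)^{2n} / (5-x)^{3n+1}`. -/
noncomputable def A (n : ℕ) (j : ℤ) : ℂ :=
  (1 / ((3 * (n : ℤ) - j).toNat.factorial : ℂ)) *
    iteratedDeriv (3 * (n : ℤ) - j).toNat
      (fun x : ℂ =>
        5 * x ^ (2 * n) * (x ^ 4 + 6 * x ^ 2 + 25) ^ (2 * n) / (5 - x) ^ (3 * n + 1))
      (-5)

/-- `inP n p` : `p` belongs to the set `𝒫_n` of primes `p > max(5, √(3n))` with
`1/2 ≤ {n/p} < 2/3`. -/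
def inP (n p : ℕ) : Prop :=
  p.Prime ∧ max 5 (Real.sqrt (3 * n)) < (p : ℝ) ∧
    1 / 2 ≤ Int.fract ((n : ℝ) / p) ∧ Int.fract ((n : ℝ) / p) < 2 / 3

/-- `Φ_n = ∏_{p ∈ 𝒫_n} p` (note `𝒫_n ⊆ {p : p ≤ 2n}`). -/
noncomputable def Phi (n : ℕ) : ℕ :=
  ∏ p ∈ (Finset.range (2 * n + 1)).filter (fun p => inP n p), p

/-- `lcm(1, 2, …, m)`. -/
def lcmUpTo (m : ℕ) : ℕ := (Finset.Icc 1 m).lcm id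

/-- `L_n = lcm(1,2,…,4n) / Φ_n`. -/
noncomputable def L (n : ℕ) : ℕ := lcmUpTo (4 * n) / Phi n

/-- The formal Taylor series at `a` of a complex function. -/
noncomputable def taylorPS (a : ℂ) (f : ℂ → ℂ) : PowerSeries ℂ :=
  PowerSeries.mk fun m => (1 / (m.factorial : ℂ)) * iteratedDeriv m f a

theorem taylorPS_mul {a : ℂ} {f g : ℂ → ℂ} (hf : ∀ m : ℕ, ContDiffAt ℂ m f a)
    (hg : ∀ m : ℕ, ContDiffAt ℂ m g a) :
    taylorPS a (fun x => f x * g x) = taylorPS a f * taylorPS a g := by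
  ext m
  rw [PowerSeries.coeff_mul, Finset.Nat.sum_antidiagonal_eq_sum_range_succ_mk]
  simp only [taylorPS, PowerSeries.coeff_mk]
  rw [iteratedDeriv_fun_mul (hf m) (hg m), Finset.mul_sum]
  refine Finset.sum_congr rfl fun i hi => ?_
  have hi' : i ≤ m := Nat.lt_succ_iff.mp (Finset.mem_range.mp hi)
  rw [Nat.cast_choose ℂ hi']
  have h1 := Nat.cast_ne_zero (R := ℂ).mpr (Nat.factorial_ne_zero m)
  have h2 := Nat.cast_ne_zero (R := ℂ).mpr (Nat.factorial_ne_zero i)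
  have h3 := Nat.cast_ne_zero (R := ℂ).mpr (Nat.factorial_ne_zero (m - i))
  field_simp

theorem taylorPS_eval (a : ℂ) (p : Polynomial ℂ) :
    taylorPS a (fun x => p.eval x) = (p.comp (Polynomial.X + Polynomial.C a) : Polynomial ℂ) := by
  ext m
  rw [Polynomial.coeff_coe, ← Polynomial.taylor_apply, Polynomial.taylor_coeff,
    taylorPS, PowerSeries.coeff_mk]
  have h : ∀ (k : ℕ) (q : Polynomial ℂ), iteratedDeriv k (fun x => q.eval x) =
      fun x => (Polynomial.derivative^[k] q).eval x := by
    intro k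
    induction k with
    | zero => intro q; simp
    | succ k ih =>
      intro q
      rw [iteratedDeriv_succ, ih]
      funext x
      rw [Polynomial.deriv, Function.iterate_succ_apply']
  rw [h m p, ← Polynomial.factorial_smul_hasseDeriv]
  have h1 := Nat.cast_ne_zero (R := ℂ).mpr (Nat.factorial_ne_zero m)
  simp [nsmul_eq_mul]
  field_simp

/-- The polynomial `(2s - 1)(5s² - 6s + 2)(5s² - 4s + 1)`, a rescaling of
`x (x⁴ + 6x² + 25)` at `x = 10s - 5`. -/
noncomputable def quinticPoly (R : Type*) [CommRing R] : Polynomial R :=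
  (2 * Polynomial.X - 1) * (5 * Polynomial.X ^ 2 - 6 * Polynomial.X + 2) *
    (5 * Polynomial.X ^ 2 - 4 * Polynomial.X + 1)

/-- The integral power series whose coefficients are the normalized Laurent coefficients. -/
noncomputable def laurentPS (n : ℕ) : PowerSeries ℤ :=
  (quinticPoly ℤ : PowerSeries ℤ) ^ (2 * n) * (PowerSeries.mk 1) ^ (3 * n + 1)

theorem laurentPS_mul (n : ℕ) :
    laurentPS n * (1 - PowerSeries.X) ^ (3 * n + 1) =
      (quinticPoly ℤ : PowerSeries ℤ) ^ (2 * n) := by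
  rw [laurentPS, mul_assoc, ← mul_pow, PowerSeries.mk_one_mul_one_sub_eq_one, one_pow, mul_one]

theorem taylorPS_laurent (n : ℕ) :
    taylorPS (-5) (fun x : ℂ =>
      5 * x ^ (2 * n) * (x ^ 4 + 6 * x ^ 2 + 25) ^ (2 * n) / (5 - x) ^ (3 * n + 1)) =
    PowerSeries.C (1 / 2 * 4 ^ n * 10 ^ (3 * n) : ℂ) *
      PowerSeries.rescale (1 / 10 : ℂ) (PowerSeries.map (Int.castRingHom ℂ) (laurentPS n)) := by
  set f : ℂ → ℂ := fun x : ℂ =>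
      5 * x ^ (2 * n) * (x ^ 4 + 6 * x ^ 2 + 25) ^ (2 * n) / (5 - x) ^ (3 * n + 1) with hf
  have hfd : ∀ m : ℕ, ContDiffAt ℂ m f (-5) := by
    intro m
    refine ContDiffAt.div (by fun_prop) (by fun_prop) ?_
    norm_num
  let pd : Polynomial ℂ := (5 - Polynomial.X) ^ (3 * n + 1)
  let pn : Polynomial ℂ := 5 * Polynomial.X ^ (2 * n) *
    (Polynomial.X ^ 4 + 6 * Polynomial.X ^ 2 + 25) ^ (2 * n)
  have hmul := taylorPS_mul (a := -5) (f := f) (g := fun x => pd.eval x) hfd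
    (fun m => by
      simp only [pd, Polynomial.eval_pow, Polynomial.eval_sub, Polynomial.eval_X,
        Polynomial.eval_ofNat]
      fun_prop)
  have hcongr : taylorPS (-5) (fun x => f x * pd.eval x) = taylorPS (-5) (fun x => pn.eval x) := by
    ext m
    simp only [taylorPS, PowerSeries.coeff_mk]
    congr 1
    apply Filter.EventuallyEq.iteratedDeriv_eq
    have hne : ∀ᶠ x : ℂ in nhds (-5), x ≠ 5 := isOpen_ne.mem_nhds (by norm_num)
    filter_upwards [hne] with x hx
    have : (5 - x) ≠ 0 := sub_ne_zero.mpr hx.symm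
    simp only [hf, pd, pn, Polynomial.eval_mul, Polynomial.eval_pow, Polynomial.eval_sub,
      Polynomial.eval_add, Polynomial.eval_X, Polynomial.eval_ofNat]
    field_simp
  rw [hcongr, taylorPS_eval, taylorPS_eval] at hmul
  have h10 : (PowerSeries.C (10 : ℂ)) * PowerSeries.C (1 / 10 : ℂ) = 1 := by
    rw [← map_mul]; norm_num
  have hG := congrArg (fun F => PowerSeries.rescale (1 / 10 : ℂ)
    (PowerSeries.map (Int.castRingHom ℂ) F)) (laurentPS_mul n)
  simp only [map_mul, map_pow, map_sub, map_one, PowerSeries.map_X, PowerSeries.rescale_X] at hG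
  set G := PowerSeries.rescale (1 / 10 : ℂ) (PowerSeries.map (Int.castRingHom ℂ) (laurentPS n))
  set T := taylorPS (-5) f
  have hU : PowerSeries.rescale (1 / 10 : ℂ) (PowerSeries.map (Int.castRingHom ℂ)
      (quinticPoly ℤ : PowerSeries ℤ)) =
      (2 * (PowerSeries.C (1 / 10) * PowerSeries.X) - 1) *
      (5 * (PowerSeries.C (1 / 10) * PowerSeries.X) ^ 2 -
        6 * (PowerSeries.C (1 / 10) * PowerSeries.X) + 2) *
      (5 * (PowerSeries.C (1 / 10) * PowerSeries.X) ^ 2 -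
        4 * (PowerSeries.C (1 / 10) * PowerSeries.X) + 1) := by
    simp only [quinticPoly, ← Polynomial.coeToPowerSeries.ringHom_apply, map_mul, map_sub, map_add,
      map_pow, map_ofNat, map_one]
    simp only [Polynomial.coeToPowerSeries.ringHom_apply, Polynomial.coe_X, PowerSeries.map_X,
      PowerSeries.rescale_X]
  rw [hU] at hG
  simp only [pn, pd, Polynomial.mul_comp, Polynomial.pow_comp, Polynomial.add_comp,
    Polynomial.sub_comp, Polynomial.X_comp, Polynomial.ofNat_comp] at hmul
  simp only [← Polynomial.coeToPowerSeries.ringHom_apply, map_mul, map_sub, map_add,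
      map_pow, map_ofNat, map_neg] at hmul
  simp only [Polynomial.coeToPowerSeries.ringHom_apply, Polynomial.coe_X] at hmul
  have hX : (PowerSeries.X : PowerSeries ℂ) =
      10 * (PowerSeries.C (1 / 10) * PowerSeries.X) := by
    rw [← mul_assoc, ← map_ofNat (PowerSeries.C (R := ℂ)) 10, h10, one_mul]
  generalize hY : PowerSeries.C (1 / 10 : ℂ) * PowerSeries.X = Y at *
  rw [hX] at hmul
  have h5 : ((5 : Polynomial ℂ) : PowerSeries ℂ) = 5 :=
    map_ofNat Polynomial.coeToPowerSeries.ringHom 5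
  have h6 : ((6 : Polynomial ℂ) : PowerSeries ℂ) = 6 :=
    map_ofNat Polynomial.coeToPowerSeries.ringHom 6
  have h25 : ((25 : Polynomial ℂ) : PowerSeries ℂ) = 25 :=
    map_ofNat Polynomial.coeToPowerSeries.ringHom 25
  simp only [Nat.cast_ofNat, h5, h6, h25] at hmul
  have hY1 : (1 - Y) ≠ 0 := by
    intro h
    have := congrArg (PowerSeries.coeff 0) h
    rw [← hY] at this
    simp at this
  have hk : PowerSeries.C (1 / 2 * 4 ^ n * 10 ^ (3 * n) : ℂ) * 10 ^ (3 * n + 1) =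
      5 * 2000 ^ (2 * n) := by
    have e : (1 / 2 * 4 ^ n * 10 ^ (3 * n) : ℂ) * 10 ^ (3 * n + 1) = 5 * 2000 ^ (2 * n) := by
      rw [pow_succ, pow_mul, pow_mul]
      have : (2000 ^ 2 : ℂ) ^ n = 4 ^ n * (10 ^ 3) ^ n * (10 ^ 3) ^ n := by
        rw [← mul_pow, ← mul_pow]; norm_num
      rw [this]; ring
    have := congrArg (PowerSeries.C (R := ℂ)) e
    rw [map_mul] at this
    simpa only [map_mul, map_pow, map_ofNat] using this
  have h10' : (10 : PowerSeries ℂ) ≠ 0 := fun h => by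
    rw [map_ofNat (PowerSeries.C (R := ℂ)) 10, h, zero_mul] at h10
    exact zero_ne_one h10
  have hprod : (10 : PowerSeries ℂ) ^ (3 * n + 1) * (1 - Y) ^ (3 * n + 1) ≠ 0 :=
    mul_ne_zero (pow_ne_zero _ h10') (pow_ne_zero _ hY1)
  apply mul_right_cancel₀ hprod
  calc T * (10 ^ (3 * n + 1) * (1 - Y) ^ (3 * n + 1))
      = T * (5 - (10 * Y + -5)) ^ (3 * n + 1) := by rw [← mul_pow]; ring
    _ = 5 * ((10 * Y + -5) * ((10 * Y + -5) ^ 4 + 6 * (10 * Y + -5) ^ 2 + 25)) ^ (2 * n) := by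
        rw [← hmul, mul_pow]; ring
    _ = 5 * (2000 * ((2 * Y - 1) * (5 * Y ^ 2 - 6 * Y + 2) * (5 * Y ^ 2 - 4 * Y + 1)))
          ^ (2 * n) := by congr 2; ring
    _ = (5 * 2000 ^ (2 * n)) * (G * (1 - Y) ^ (3 * n + 1)) := by rw [hG, mul_pow]; ring
    _ = _ := by rw [← hk]; ring

/-- The integer coefficient attached to the index `j`. -/
noncomputable def laurentCoeff (n j : ℕ) : ℤ := PowerSeries.coeff (3 * n - j) (laurentPS n)

theorem A_eq {n j : ℕ} (hj : j ≤ 3 * n) :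
    A n (j : ℤ) = 1 / 2 * 4 ^ n * 10 ^ j * (laurentCoeff n j : ℂ) := by
  have hto : (3 * (n : ℤ) - (j : ℤ)).toNat = 3 * n - j := by omega
  have h := congrArg (PowerSeries.coeff (3 * n - j)) (taylorPS_laurent n)
  rw [taylorPS, PowerSeries.coeff_mk, PowerSeries.coeff_C_mul, PowerSeries.coeff_rescale,
    PowerSeries.coeff_map] at h
  rw [A, hto, h]
  have hp : (10 : ℂ) ^ (3 * n) = 10 ^ j * 10 ^ (3 * n - j) := by
    rw [← pow_add]; congr 1; omega
  rw [hp, laurentCoeff, one_div_pow]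
  simp only [eq_intCast]
  field_simp

/-- `f` is `2`-adically of weight `w` if `2 ^ ⌈(w - m) / 2⌉` divides its `m`-th coefficient. -/
def HasTwoWeight (w : ℕ) (f : PowerSeries ℤ) : Prop :=
  ∀ m, (2 : ℤ) ^ ((w + 1 - m) / 2) ∣ PowerSeries.coeff m f

theorem HasTwoWeight.mul {w v : ℕ} {f g : PowerSeries ℤ} (hf : HasTwoWeight w f)
    (hg : HasTwoWeight v g) : HasTwoWeight (w + v) (f * g) := by
  intro m
  rw [PowerSeries.coeff_mul]
  refine Finset.dvd_sum fun ij hij => ?_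
  have hm := Finset.HasAntidiagonal.mem_antidiagonal.mp hij
  refine dvd_trans (pow_dvd_pow 2 ?_) (pow_add (2 : ℤ) _ _ ▸ mul_dvd_mul (hf ij.1) (hg ij.2))
  omega

theorem HasTwoWeight.of_zero (f : PowerSeries ℤ) : HasTwoWeight 0 f := by
  intro m
  have : (0 + 1 - m) / 2 = 0 := by omega
  simp [this]

theorem HasTwoWeight.pow {w : ℕ} {f : PowerSeries ℤ} (hf : HasTwoWeight w f) (k : ℕ) :
    HasTwoWeight (k * w) (f ^ k) := by
  induction k with
  | zero => rw [Nat.zero_mul]; exact .of_zero _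
  | succ k ih => rw [pow_succ, Nat.succ_mul]; exact ih.mul hf

theorem two_pow_dvd_laurentCoeff {n j : ℕ} (hj : j ≤ 3 * n) :
    (2 : ℤ) ^ ((n + j + 1) / 2) ∣ laurentCoeff n j := by
  have hq : HasTwoWeight 2
      ((5 * Polynomial.X ^ 2 - 6 * Polynomial.X + 2 : Polynomial ℤ) : PowerSeries ℤ) := by
    intro m
    rw [Polynomial.coeff_coe]
    rcases m with _ | _ | m
    · simp
    · simp [Polynomial.coeff_X]
    · have : (2 + 1 - (m + 1 + 1)) / 2 = 0 := by omega
      rw [this, pow_zero]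
      exact one_dvd _
  have h := ((HasTwoWeight.of_zero ((2 * Polynomial.X - 1 : Polynomial ℤ) : PowerSeries ℤ)).mul
    hq).mul (.of_zero ((5 * Polynomial.X ^ 2 - 4 * Polynomial.X + 1 : Polynomial ℤ) :
      PowerSeries ℤ))
  have h2 := ((h.pow (2 * n)).mul (.of_zero ((PowerSeries.mk 1) ^ (3 * n + 1)))) (3 * n - j)
  rw [laurentCoeff, laurentPS, quinticPoly, Polynomial.coe_mul, Polynomial.coe_mul]
  refine dvd_trans (pow_dvd_pow 2 ?_) h2
  omega

theorem quinticPoly_eval_one_sub {R : Type*} [CommRing R] (x : R) :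
    (quinticPoly R).eval (1 - x) = -(quinticPoly R).eval x := by
  simp only [quinticPoly, Polynomial.eval_mul, Polynomial.eval_sub, Polynomial.eval_add,
    Polynomial.eval_pow, Polynomial.eval_X, Polynomial.eval_ofNat, Polynomial.eval_one]
  ring

theorem quinticPoly_natDegree_le (R : Type*) [CommRing R] : (quinticPoly R).natDegree ≤ 5 := by
  unfold quinticPoly
  compute_degree

/-- Summing a polynomial of degree less than `2 (p - 1)` over `ZMod p` picks out the coefficient
of index `p - 1`. -/
theorem sum_eval_zmod {p : ℕ} [Fact p.Prime] (P : Polynomial (ZMod p))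
    (hP : P.natDegree < 2 * (p - 1)) : ∑ x : ZMod p, P.eval x = -P.coeff (p - 1) := by
  have hp := (Fact.out : p.Prime).two_le
  simp only [Polynomial.eval_eq_sum_range' hP]
  rw [Finset.sum_comm]
  simp only [← Finset.mul_sum]
  rw [Finset.sum_eq_single (p - 1)]
  · have h1 : ∑ x : ZMod p, x ^ (p - 1) = -1 := by
      have h : ∀ x : ZMod p, x ^ (p - 1) = 1 - if x = 0 then 1 else 0 := by
        intro x
        split_ifs with hx
        · rw [hx, zero_pow (by omega)]; ring
        · rw [ZMod.pow_card_sub_one_eq_one hx]; ring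
      simp [h]
    rw [h1]; ring
  · intro m hm hne
    have hm' := Finset.mem_range.mp hm
    rcases lt_or_gt_of_ne hne with h | h
    · rw [FiniteField.sum_pow_lt_card_sub_one (ZMod p) m (by rwa [ZMod.card]), mul_zero]
    · have h2 : ∀ x : ZMod p, x ^ m = x ^ (m - (p - 1)) := by
        intro x
        by_cases hx : x = 0
        · rw [hx, zero_pow (by omega), zero_pow (by omega)]
        · conv_lhs => rw [show m = (m - (p - 1)) + (p - 1) by omega, pow_add,
            ZMod.pow_card_sub_one_eq_one hx, mul_one]
      simp only [h2]
      rw [FiniteField.sum_pow_lt_card_sub_one (ZMod p) _ (by rw [ZMod.card]; omega), mul_zero]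
  · intro h
    exact absurd (Finset.mem_range.mpr (by omega)) h

theorem coeff_pow_prime_eq_zero {p : ℕ} [Fact p.Prime] (H : PowerSeries (ZMod p)) {m : ℕ}
    (hm : ¬ p ∣ m) : PowerSeries.coeff m (H ^ p) = 0 := by
  obtain ⟨k, rfl⟩ : ∃ k, m = k + 1 :=
    Nat.exists_eq_succ_of_ne_zero (fun h => hm (h ▸ dvd_zero p))
  have h := PowerSeries.coeff_derivative (H ^ p) k
  have hp0 : (p : PowerSeries (ZMod p)) = 0 := by
    rw [← map_natCast (PowerSeries.C (R := ZMod p)), CharP.cast_eq_zero, map_zero]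
  rw [PowerSeries.derivative_pow, hp0, zero_mul, zero_mul, map_zero] at h
  rcases mul_eq_zero.mp h.symm with h | h
  · exact h
  · exact absurd ((ZMod.natCast_eq_zero_iff _ _).mp (by exact_mod_cast h)) hm

/-- A polynomial that is odd under `x ↦ 1 - x` and has degree less than `2 (p - 1)` contributes
nothing to the coefficients of index `≡ -1 mod p` when multiplied by a `p`-th power. -/
theorem coeff_pow_prime_mul_eq_zero {p : ℕ} [Fact p.Prime] (hp2 : p ≠ 2)
    (H : PowerSeries (ZMod p)) (P : Polynomial (ZMod p)) (hP : P.natDegree < 2 * (p - 1))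
    (hodd : ∀ x, P.eval (1 - x) = -P.eval x) {m : ℕ} (hm : p ∣ m + 1) :
    PowerSeries.coeff m (H ^ p * (P : PowerSeries (ZMod p))) = 0 := by
  have hp := (Fact.out : p.Prime).two_le
  have hsum : ∑ x : ZMod p, P.eval x = 0 := by
    have h : ∑ x : ZMod p, P.eval (1 - x) = ∑ x : ZMod p, P.eval x :=
      Equiv.sum_comp (Equiv.subLeft (1 : ZMod p)) (fun x => P.eval x)
    simp only [hodd, Finset.sum_neg_distrib] at h
    have h2 : (2 : ZMod p) * ∑ x : ZMod p, P.eval x = 0 := by linear_combination -h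
    rcases mul_eq_zero.mp h2 with h3 | h3
    · exfalso
      have h4 : ((2 : ℕ) : ZMod p) = 0 := by exact_mod_cast h3
      rw [ZMod.natCast_eq_zero_iff] at h4
      exact hp2 (le_antisymm (Nat.le_of_dvd (by norm_num) h4) hp)
    · exact h3
  have hc : P.coeff (p - 1) = 0 := by
    rw [sum_eval_zmod P hP] at hsum
    exact neg_eq_zero.mp hsum
  rw [PowerSeries.coeff_mul]
  refine Finset.sum_eq_zero fun ij hij => ?_
  have hm' := Finset.HasAntidiagonal.mem_antidiagonal.mp hij
  by_cases hd : p ∣ ij.1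
  · rw [Polynomial.coeff_coe]
    have h2 : p ∣ ij.2 + 1 := by
      rw [← hm', add_assoc] at hm
      exact (Nat.dvd_add_right hd).mp hm
    obtain ⟨c, hc'⟩ := h2
    rcases c with _ | _ | c
    · omega
    · rw [show ij.2 = p - 1 by omega, hc, mul_zero]
    · rw [Polynomial.coeff_eq_zero_of_natDegree_lt, mul_zero]
      have : p * (c + 1 + 1) = p * c + 2 * p := by ring
      omega
  · rw [coeff_pow_prime_eq_zero H hd, zero_mul]

theorem prime_dvd_laurentCoeff {n p j k r : ℕ} (hp : p.Prime) (hp2 : p ≠ 2)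
    (hn : n = k * p + r) (hr : p ≤ 2 * r) (hr' : 3 * r < 2 * p) (hj : j ≤ 3 * n) (hpj : p ∣ j) :
    (p : ℤ) ∣ laurentCoeff n j := by
  have : Fact p.Prime := ⟨hp⟩
  set d := 2 * r - p with hd
  set e := 2 * p - 3 * r - 1 with he
  rw [← ZMod.intCast_zmod_eq_zero_iff_dvd]
  set U : PowerSeries (ZMod p) := (quinticPoly (ZMod p) : PowerSeries (ZMod p)) with hU
  set S : PowerSeries (ZMod p) := PowerSeries.mk 1 with hS
  have hS1 : S * (1 - PowerSeries.X) = 1 := PowerSeries.mk_one_mul_one_sub_eq_one _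
  let P : Polynomial (ZMod p) :=
    Polynomial.X ^ e * (1 - Polynomial.X) ^ e * quinticPoly (ZMod p) ^ d
  have hmap : PowerSeries.map (Int.castRingHom (ZMod p)) (laurentPS n) =
      U ^ (2 * n) * S ^ (3 * n + 1) := by
    rw [laurentPS, map_mul, map_pow, map_pow]
    congr 2
    · rw [hU]
      simp only [quinticPoly, ← Polynomial.coeToPowerSeries.ringHom_apply, map_mul, map_sub,
        map_add, map_pow, map_ofNat, map_one]
      simp only [Polynomial.coeToPowerSeries.ringHom_apply, Polynomial.coe_X, PowerSeries.map_X]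
    · ext m
      simp [hS]
  have hkey : PowerSeries.X ^ e * (U ^ (2 * n) * S ^ (3 * n + 1)) =
      (U ^ (2 * k + 1) * S ^ (3 * k + 2)) ^ p * (P : PowerSeries (ZMod p)) := by
    have e1 : 2 * n = (2 * k + 1) * p + d := by
      have : (2 * k + 1) * p = 2 * (k * p) + p := by ring
      omega
    have e2 : 3 * n + 1 + e = (3 * k + 2) * p := by
      have : (3 * k + 2) * p = 3 * (k * p) + 2 * p := by ring
      omega
    have hcoe : (P : PowerSeries (ZMod p)) =
        PowerSeries.X ^ e * (1 - PowerSeries.X) ^ e * U ^ d := by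
      simp [P, hU]
    have hone : S ^ e * (1 - PowerSeries.X) ^ e = 1 := by rw [← mul_pow, hS1, one_pow]
    calc PowerSeries.X ^ e * (U ^ (2 * n) * S ^ (3 * n + 1))
        = PowerSeries.X ^ e * (U ^ (2 * n) * S ^ (3 * n + 1)) *
          (S ^ e * (1 - PowerSeries.X) ^ e) := by rw [hone, mul_one]
      _ = PowerSeries.X ^ e * U ^ (2 * n) * S ^ (3 * n + 1 + e) * (1 - PowerSeries.X) ^ e := by
          rw [pow_add S]; ring
      _ = _ := by rw [hcoe, e1, e2, pow_add, mul_pow, ← pow_mul, ← pow_mul]; ring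
  have hdeg : P.natDegree < 2 * (p - 1) := by
    have h1 : P.natDegree ≤ e + e * 1 + d * 5 := by
      refine Polynomial.natDegree_mul_le_of_le (Polynomial.natDegree_mul_le_of_le ?_ ?_) ?_
      · exact Polynomial.natDegree_X_pow_le e
      · exact Polynomial.natDegree_pow_le_of_le e (by compute_degree)
      · exact Polynomial.natDegree_pow_le_of_le d (quinticPoly_natDegree_le _)
    omega
  have hdodd : Odd d := by
    rcases hp.eq_two_or_odd with h | h
    · exact absurd h hp2
    · rw [Nat.odd_iff]; omega
  have hodd : ∀ x, P.eval (1 - x) = -P.eval x := by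
    intro x
    simp only [P, Polynomial.eval_mul, Polynomial.eval_pow, Polynomial.eval_sub,
      Polynomial.eval_X, Polynomial.eval_one, quinticPoly_eval_one_sub, hdodd.neg_pow]
    ring
  have hz := coeff_pow_prime_mul_eq_zero hp2 (U ^ (2 * k + 1) * S ^ (3 * k + 2)) P hdeg hodd
    (m := 3 * n - j + e) (by
      have h3 : 3 * n - j + e + 1 + j = (3 * k + 2) * p := by
        have : (3 * k + 2) * p = 3 * (k * p) + 2 * p := by ring
        omega
      exact (Nat.dvd_add_left hpj).mp (h3 ▸ dvd_mul_left p _))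
  rw [← hkey, ← hmap, PowerSeries.coeff_X_pow_mul, PowerSeries.coeff_map] at hz
  exact hz

theorem exists_two_add_I_pow (j : ℕ) : ∃ x y : ℤ,
    (2 + Complex.I) ^ j = x + y * Complex.I ∧ (2 - Complex.I) ^ j = x - y * Complex.I := by
  induction j with
  | zero => exact ⟨1, 0, by simp, by simp⟩
  | succ j ih =>
    obtain ⟨x, y, h1, h2⟩ := ih
    refine ⟨2 * x - y, x + 2 * y, ?_, ?_⟩
    · rw [pow_succ, h1]; push_cast; linear_combination y * Complex.I_sq
    · rw [pow_succ, h2]; push_cast; linear_combination y * Complex.I_sq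

theorem exists_three_add_I_pow (n j : ℕ) : ∃ x y : ℤ,
    2 ^ ((n + j + 1) / 2) * ((3 + Complex.I) / 2) ^ j = 2 ^ (n / 2) * (x + y * Complex.I) ∧
    2 ^ ((n + j + 1) / 2) * ((3 - Complex.I) / 2) ^ j = 2 ^ (n / 2) * (x - y * Complex.I) := by
  induction j using Nat.twoStepInduction with
  | zero =>
    refine ⟨2 ^ ((n + 1) / 2 - n / 2), 0, ?_⟩
    have h : (2 : ℂ) ^ ((n + 1) / 2) = 2 ^ (n / 2) * 2 ^ ((n + 1) / 2 - n / 2) := by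
      rw [← pow_add]; congr 1; omega
    simp [h]
  | one =>
    refine ⟨3, 1, ?_⟩
    have h : (2 : ℂ) ^ ((n + 1 + 1) / 2) = 2 ^ (n / 2) * 2 := by
      rw [← pow_succ]; congr 1; omega
    rw [h]
    constructor <;> (push_cast; ring)
  | more j ih _ =>
    obtain ⟨x, y, h1, h2⟩ := ih
    refine ⟨4 * x - 3 * y, 3 * x + 4 * y, ?_⟩
    have h : (2 : ℂ) ^ ((n + (j + 2) + 1) / 2) = 2 ^ ((n + j + 1) / 2) * 2 := by
      rw [← pow_succ]; congr 1; omega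
    have e1 : 2 * ((3 + Complex.I) / 2) ^ 2 = 4 + 3 * Complex.I := by
      linear_combination (1 / 2) * Complex.I_sq
    have e2 : 2 * ((3 - Complex.I) / 2) ^ 2 = 4 - 3 * Complex.I := by
      linear_combination (1 / 2) * Complex.I_sq
    rw [h]
    constructor
    · calc _ = (2 ^ ((n + j + 1) / 2) * ((3 + Complex.I) / 2) ^ j) *
            (2 * ((3 + Complex.I) / 2) ^ 2) := by ring
        _ = _ := by
          rw [h1, e1]; push_cast
          linear_combination 2 ^ (n / 2) * 3 * y * Complex.I_sq
    · calc _ = (2 ^ ((n + j + 1) / 2) * ((3 - Complex.I) / 2) ^ j) *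
            (2 * ((3 - Complex.I) / 2) ^ 2) := by ring
        _ = _ := by
          rw [h2, e2]; push_cast
          linear_combination 2 ^ (n / 2) * 3 * y * Complex.I_sq

theorem exists_endpoint_eq (n j : ℕ) : ∃ d : ℤ,
    2 ^ ((n + j + 1) / 2) * (Complex.I * ((2 + Complex.I) ^ j - (2 - Complex.I) ^ j +
      ((3 + Complex.I) / 2) ^ j - ((3 - Complex.I) / 2) ^ j)) = 2 * 2 ^ (n / 2) * (d : ℂ) := by
  obtain ⟨x, y, h1, h2⟩ := exists_two_add_I_pow j
  obtain ⟨u, v, h3, h4⟩ := exists_three_add_I_pow n j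
  refine ⟨-(2 ^ ((n + j + 1) / 2 - n / 2) * y) - v, ?_⟩
  have h : (2 : ℂ) ^ ((n + j + 1) / 2) = 2 ^ (n / 2) * 2 ^ ((n + j + 1) / 2 - n / 2) := by
    rw [← pow_add]; congr 1; omega
  calc _ = 2 ^ ((n + j + 1) / 2) * (Complex.I * ((2 + Complex.I) ^ j - (2 - Complex.I) ^ j)) +
        Complex.I * (2 ^ ((n + j + 1) / 2) * ((3 + Complex.I) / 2) ^ j -
          2 ^ ((n + j + 1) / 2) * ((3 - Complex.I) / 2) ^ j) := by ring
    _ = _ := by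
      rw [h3, h4, h1, h2, h]; push_cast
      linear_combination (2 * 2 ^ (n / 2) * 2 ^ ((n + j + 1) / 2 - n / 2) * y +
        2 * 2 ^ (n / 2) * v) * Complex.I_sq

theorem hasDerivAt_inv_pow {g : ℝ → ℂ} {g' : ℂ} {t : ℝ} {j : ℕ} (hj : j ≠ 0)
    (hg : HasDerivAt g g' t) (h0 : g t ≠ 0) :
    HasDerivAt (fun t => -(1 / (j : ℂ)) * ((g t) ^ j)⁻¹) (1 / (g t) ^ (j + 1) * g') t := by
  have h := ((hg.fun_pow j).fun_inv (pow_ne_zero j h0)).const_mul (-(1 / (j : ℂ)))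
  refine h.congr_deriv ?_
  obtain ⟨k, rfl⟩ := Nat.exists_eq_succ_of_ne_zero hj
  have hk : ((k : ℂ) + 1) ≠ 0 := by exact_mod_cast Nat.succ_ne_zero k
  simp only [Nat.succ_eq_add_one, Nat.add_sub_cancel, Nat.cast_add, Nat.cast_one]
  field_simp
  ring

theorem integral_laurent (n : ℕ) :
    (∫ t in (-1 : ℝ)..1,
      (∑ j ∈ Finset.Icc 1 (3 * n),
        A n (j : ℤ) * (1 / (5 + (-1 + 2 * Complex.I * t)) ^ (j + 1) +
          1 / (5 - (-1 + 2 * Complex.I * t)) ^ (j + 1))) * (2 * Complex.I)) =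
    ∑ j ∈ Finset.Icc 1 (3 * n), A n (j : ℤ) * (1 / (j : ℂ)) *
      (((4 - 2 * Complex.I) ^ j)⁻¹ - ((4 + 2 * Complex.I) ^ j)⁻¹ +
        ((6 - 2 * Complex.I) ^ j)⁻¹ - ((6 + 2 * Complex.I) ^ j)⁻¹) := by
  have hne1 : ∀ t : ℝ, (5 + (-1 + 2 * Complex.I * t) : ℂ) ≠ 0 := fun t h => by
    have := congrArg Complex.re h
    norm_num at this
  have hne2 : ∀ t : ℝ, (5 - (-1 + 2 * Complex.I * t) : ℂ) ≠ 0 := fun t h => by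
    have := congrArg Complex.re h
    norm_num at this
  have hx : ∀ t : ℝ, HasDerivAt (fun t : ℝ => (-1 + 2 * Complex.I * t : ℂ)) (2 * Complex.I) t := by
    intro t
    simpa using ((Complex.ofRealCLM.hasDerivAt (x := t)).const_mul (2 * Complex.I)).const_add (-1)
  rw [intervalIntegral.integral_eq_sub_of_hasDerivAt (f := fun t : ℝ =>
    ∑ j ∈ Finset.Icc 1 (3 * n), A n (j : ℤ) *
      (-(1 / (j : ℂ)) * ((5 + (-1 + 2 * Complex.I * t)) ^ j)⁻¹ -
        -(1 / (j : ℂ)) * ((5 - (-1 + 2 * Complex.I * t)) ^ j)⁻¹))]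
  · rw [← Finset.sum_sub_distrib]
    refine Finset.sum_congr rfl fun j _ => ?_
    push_cast
    rw [show (5 + (-1 + 2 * Complex.I * 1) : ℂ) = 4 + 2 * Complex.I by ring,
      show (5 - (-1 + 2 * Complex.I * 1) : ℂ) = 6 - 2 * Complex.I by ring,
      show (5 + (-1 + 2 * Complex.I * -1) : ℂ) = 4 - 2 * Complex.I by ring,
      show (5 - (-1 + 2 * Complex.I * -1) : ℂ) = 6 + 2 * Complex.I by ring]
    ring
  · intro t _
    rw [Finset.sum_mul]
    refine HasDerivAt.fun_sum fun j hj => ?_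
    have hj0 : j ≠ 0 := by have := (Finset.mem_Icc.mp hj).1; omega
    have h1 := hasDerivAt_inv_pow hj0 ((hx t).const_add 5) (hne1 t)
    have h2 := hasDerivAt_inv_pow hj0 ((hx t).const_sub 5) (hne2 t)
    refine ((h1.fun_sub h2).const_mul (A n (j : ℤ))).congr_deriv ?_
    ring
  · apply Continuous.intervalIntegrable
    refine Continuous.mul (continuous_finsetSum _ fun j _ => ?_) continuous_const
    refine continuous_const.mul (Continuous.add ?_ ?_)
    · exact continuous_const.div (by fun_prop) fun t => pow_ne_zero _ (hne1 t)
    · exact continuous_const.div (by fun_prop) fun t => pow_ne_zero _ (hne2 t)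

theorem lcmUpTo_ne_zero (m : ℕ) : lcmUpTo m ≠ 0 := by
  rw [lcmUpTo, Ne, Finset.lcm_eq_zero_iff]
  simp

theorem dvd_lcmUpTo {k m : ℕ} (hk : k ≠ 0) (hkm : k ≤ m) : k ∣ lcmUpTo m :=
  Finset.dvd_lcm (f := id) (Finset.mem_Icc.mpr ⟨Nat.one_le_iff_ne_zero.mpr hk, hkm⟩)

theorem Phi_dvd_lcmUpTo (n : ℕ) : Phi n ∣ lcmUpTo (4 * n) := by
  refine Finset.prod_primes_dvd _ (fun p hp => ?_) fun p hp => ?_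
  · exact (Finset.mem_filter.mp hp).2.1.prime
  · have h := Finset.mem_filter.mp hp
    have := Finset.mem_range.mp h.1
    exact dvd_lcmUpTo h.2.1.ne_zero (by omega)

theorem L_mul_Phi (n : ℕ) : L n * Phi n = lcmUpTo (4 * n) :=
  Nat.div_mul_cancel (Phi_dvd_lcmUpTo n)

theorem inP.dvd_laurentCoeff {n p j : ℕ} (h : inP n p) (hj : j ≤ 3 * n) (hpj : p ∣ j) :
    (p : ℤ) ∣ laurentCoeff n j := by
  obtain ⟨hp, hmax, h1, h2⟩ := h
  have hp0 : (0 : ℝ) < p := by exact_mod_cast hp.pos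
  rw [Int.fract_div_natCast_eq_div_natCast_mod, div_le_div_iff₀ (by norm_num) hp0] at h1
  rw [Int.fract_div_natCast_eq_div_natCast_mod, div_lt_div_iff₀ hp0 (by norm_num)] at h2
  have hp5 : (5 : ℝ) < p := lt_of_le_of_lt (le_max_left _ _) hmax
  have hp5' : 5 < p := by exact_mod_cast hp5
  have h1' : 1 * p ≤ n % p * 2 := by exact_mod_cast h1
  have h2' : n % p * 3 < 2 * p := by exact_mod_cast h2
  exact prime_dvd_laurentCoeff (k := n / p) (r := n % p) hp (by omega)
    (Nat.div_add_mod' n p).symm (by omega) (by omega) hj hpj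

theorem inP.sq_gt {n p : ℕ} (h : inP n p) : 3 * n < p ^ 2 := by
  have h1 : Real.sqrt (3 * n) < p := lt_of_le_of_lt (le_max_right _ _) h.2.1
  have h2 := (Real.sqrt_lt' (by exact_mod_cast h.1.pos)).mp h1
  exact_mod_cast h2

theorem inP.five_lt {n p : ℕ} (h : inP n p) : 5 < p := by
  have h1 : (5 : ℝ) < p := lt_of_le_of_lt (le_max_left _ _) h.2.1
  exact_mod_cast h1

/-- If every prime of `𝒫_n` dividing `j` also divides `c`, then `j ∣ L_n c`. -/
theorem dvd_L_mul {n j c : ℕ} (hj0 : j ≠ 0) (hj : j ≤ 3 * n)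
    (hc : ∀ p, inP n p → p ∣ j → p ∣ c) : j ∣ L n * c := by
  set s := (Finset.range (2 * n + 1)).filter (fun p => inP n p) with hs
  set g := ∏ p ∈ s.filter (fun p => p ∣ j), p with hg
  have hprime : ∀ p ∈ s.filter (fun p => p ∣ j), Prime p := fun p hp =>
    (Finset.mem_filter.mp (Finset.mem_filter.mp hp).1).2.1.prime
  have hgj : g ∣ j := Finset.prod_primes_dvd _ hprime fun p hp => (Finset.mem_filter.mp hp).2
  have hgc : g ∣ c := Finset.prod_primes_dvd _ hprime fun p hp =>
    hc p (Finset.mem_filter.mp (Finset.mem_filter.mp hp).1).2 (Finset.mem_filter.mp hp).2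
  obtain ⟨k, hk⟩ := hgj
  have hcop : Nat.Coprime k (Phi n) := by
    refine Nat.Coprime.prod_right fun p hp => ?_
    have hP := (Finset.mem_filter.mp hp).2
    refine ((Nat.Prime.coprime_iff_not_dvd hP.1).mpr fun hpk => ?_).symm
    have hpj : p ∣ j := hk ▸ dvd_mul_of_dvd_right hpk g
    have hpg : p ∣ g := Finset.dvd_prod_of_mem (fun p => p) (Finset.mem_filter.mpr ⟨hp, hpj⟩)
    have h2 : p ^ 2 ∣ j := by
      rw [hk, sq]; exact mul_dvd_mul hpg hpk
    have h3 := Nat.le_of_dvd (Nat.pos_of_ne_zero hj0) h2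
    have h4 := hP.sq_gt
    omega
  have hkL : k ∣ L n := by
    refine hcop.dvd_of_dvd_mul_right ?_
    rw [L_mul_Phi]
    exact (hk ▸ dvd_mul_left k g : k ∣ j).trans (dvd_lcmUpTo hj0 (by omega))
  rw [hk, mul_comm g k]
  exact mul_dvd_mul hkL hgc

/-- The contribution of a single index `j` is `2 ^ ⌊5n/2⌋ / L_n` times an integer. -/
theorem exists_term_eq {n j : ℕ} (hj1 : 1 ≤ j) (hj : j ≤ 3 * n) : ∃ m : ℤ,
    (L n : ℂ) * (Complex.I * (A n (j : ℤ) * (1 / (j : ℂ)) *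
      (((4 - 2 * Complex.I) ^ j)⁻¹ - ((4 + 2 * Complex.I) ^ j)⁻¹ +
        ((6 - 2 * Complex.I) ^ j)⁻¹ - ((6 + 2 * Complex.I) ^ j)⁻¹))) =
      2 ^ (5 * n / 2) * (m : ℂ) := by
  obtain ⟨c, hc⟩ := two_pow_dvd_laurentCoeff hj
  obtain ⟨d, hd⟩ := exists_endpoint_eq n j
  have hdvd : (j : ℤ) ∣ (L n : ℤ) * c := by
    rw [← Int.natAbs_dvd_natAbs, Int.natAbs_mul, Int.natAbs_natCast, Int.natAbs_natCast]
    refine dvd_L_mul (by omega) hj fun p hp hpj => ?_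
    have h := hp.dvd_laurentCoeff hj hpj
    rw [hc] at h
    rcases (Nat.prime_iff_prime_int.mp hp.1).dvd_or_dvd h with h | h
    · have h2 := (Nat.prime_iff_prime_int.mp hp.1).dvd_of_dvd_pow h
      have h3 : p ∣ 2 := by exact_mod_cast h2
      have h4 := Nat.le_of_dvd (by norm_num) h3
      have h5 := hp.five_lt
      omega
    · exact Int.natCast_dvd.mp h
  obtain ⟨b, hb⟩ := hdvd
  have hb' : (L n : ℂ) * c = j * b := by exact_mod_cast hb
  refine ⟨b * d, ?_⟩
  have hj0 : (j : ℂ) ≠ 0 := by exact_mod_cast (by omega : j ≠ 0)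
  have key : ∀ z w : ℂ, z * w = 10 → 10 ^ j * (z ^ j)⁻¹ = w ^ j := by
    intro z w h
    have hz : z ≠ 0 := by rintro rfl; norm_num at h
    rw [← h, mul_pow]
    field_simp
  have k1 := key (4 - 2 * Complex.I) (2 + Complex.I) (by linear_combination -2 * Complex.I_sq)
  have k2 := key (4 + 2 * Complex.I) (2 - Complex.I) (by linear_combination -2 * Complex.I_sq)
  have k3 := key (6 - 2 * Complex.I) ((3 + Complex.I) / 2) (by linear_combination -Complex.I_sq)
  have k4 := key (6 + 2 * Complex.I) ((3 - Complex.I) / 2) (by linear_combination -Complex.I_sq)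
  have hpow : (2 : ℂ) ^ (5 * n / 2) = 4 ^ n * 2 ^ (n / 2) := by
    rw [show (4 : ℂ) = 2 ^ 2 by norm_num, ← pow_mul, ← pow_add]; congr 1; omega
  rw [A_eq hj, hc, hpow]
  push_cast
  calc _ = (1 / 2 * 4 ^ n) * (((L n : ℂ) * c) / j) * (2 ^ ((n + j + 1) / 2) * (Complex.I *
        (10 ^ j * ((4 - 2 * Complex.I) ^ j)⁻¹ - 10 ^ j * ((4 + 2 * Complex.I) ^ j)⁻¹ +
        10 ^ j * ((6 - 2 * Complex.I) ^ j)⁻¹ - 10 ^ j * ((6 + 2 * Complex.I) ^ j)⁻¹))) := by ring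
    _ = _ := by
      rw [k1, k2, k3, k4, hd, hb', mul_div_cancel_left₀ _ hj0]; ring

theorem L_ne_zero (n : ℕ) : L n ≠ 0 := fun h =>
  lcmUpTo_ne_zero (4 * n) (by rw [← L_mul_Phi, h, zero_mul])

/-- **Lemma 6.** The number
`i ∫_{-1-2i}^{-1+2i} Σ_{j=1}^{3n} A_j(n) (1/(5+x)^{j+1} + 1/(5-x)^{j+1}) dx`
(integral along the straight segment, parametrized by `x = -1 + 2it`, `t ∈ [-1,1]`)
is rational, and `2^{-⌊5n/2⌋+1} L_n` times this number is an integer. -/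
theorem Lemma6 (n : ℕ) (hn : 1 ≤ n) :
    (∃ q : ℚ, Complex.I *
        (∫ t in (-1 : ℝ)..1,
          (∑ j ∈ Finset.Icc 1 (3 * n),
            A n (j : ℤ) * (1 / (5 + (-1 + 2 * Complex.I * t)) ^ (j + 1) +
              1 / (5 - (-1 + 2 * Complex.I * t)) ^ (j + 1))) * (2 * Complex.I)) = (q : ℂ)) ∧
      ∃ m : ℤ, (2 : ℂ) ^ (1 - ((5 * n / 2 : ℕ) : ℤ)) * (L n : ℂ) *
        (Complex.I *
          (∫ t in (-1 : ℝ)..1,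
            (∑ j ∈ Finset.Icc 1 (3 * n),
              A n (j : ℤ) * (1 / (5 + (-1 + 2 * Complex.I * t)) ^ (j + 1) +
                1 / (5 - (-1 + 2 * Complex.I * t)) ^ (j + 1))) * (2 * Complex.I))) = (m : ℂ) := by
  obtain ⟨m, hm⟩ : ∃ m : ℤ, (L n : ℂ) * (Complex.I *
      (∫ t in (-1 : ℝ)..1,
        (∑ j ∈ Finset.Icc 1 (3 * n),
          A n (j : ℤ) * (1 / (5 + (-1 + 2 * Complex.I * t)) ^ (j + 1) +
            1 / (5 - (-1 + 2 * Complex.I * t)) ^ (j + 1))) * (2 * Complex.I))) =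
      2 ^ (5 * n / 2) * (m : ℂ) := by
    choose! b hb using fun (j : ℕ) (h : j ∈ Finset.Icc 1 (3 * n)) =>
      exists_term_eq (Finset.mem_Icc.mp h).1 (Finset.mem_Icc.mp h).2
    refine ⟨∑ j ∈ Finset.Icc 1 (3 * n), b j, ?_⟩
    rw [integral_laurent, Finset.mul_sum, Finset.mul_sum, Int.cast_sum, Finset.mul_sum]
    exact Finset.sum_congr rfl hb
  generalize Complex.I * (∫ t in (-1 : ℝ)..1,
        (∑ j ∈ Finset.Icc 1 (3 * n),
          A n (j : ℤ) * (1 / (5 + (-1 + 2 * Complex.I * t)) ^ (j + 1) +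
            1 / (5 - (-1 + 2 * Complex.I * t)) ^ (j + 1))) * (2 * Complex.I)) = N at hm ⊢
  constructor
  · refine ⟨2 ^ (5 * n / 2) * m / L n, ?_⟩
    have hL : (L n : ℂ) ≠ 0 := by exact_mod_cast L_ne_zero n
    push_cast
    rw [← hm, mul_div_cancel_left₀ _ hL]
  · refine ⟨2 * m, ?_⟩
    rw [mul_assoc, hm, zpow_sub₀ two_ne_zero, zpow_one, zpow_natCast]
    push_cast
    field_simp
end

section
/- Let a_n, b_n be the unique rational numbers with I_n = a_n + b_n·π (they exist by Proposition 1 and are unique because π is irrational). Then lim_{n→∞} |b_n|^{1/n} = N₃, where N₃ is the unique real root of the cubic polynomial 108N³ − 2359989N² + 138304N − 2048, which lies in the interval (21851, 21852). -/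
/-- The rational function `R_n(x) = 5 x^{2n} (x⁴+6x²+25)^{2n} / ((5+x)^{3n+1} (5-x)^{3n+1})`. -/
noncomputable def R (n : ℕ) : ℂ → ℂ := fun x =>
  5 * x ^ (2 * n) * (x ^ 4 + 6 * x ^ 2 + 25) ^ (2 * n) /
    ((5 + x) ^ (3 * n + 1) * (5 - x) ^ (3 * n + 1))

/-- `I_n = i (-1)^{n+1} ∫ R_n(x) dx` along the straight segment from `-1-2i` to `-1+2i`. -/
noncomputable def In (n : ℕ) : ℂ :=
  Complex.I * (-1) ^ (n + 1) *
    ∫ t in (-1 : ℝ)..1, R n (-1 + 2 * Complex.I * t) * (2 * Complex.I)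

open PowerSeries Filter Topology Finset

/-- The power series `f` converges absolutely at `s`, with sum `v`. -/
def EvalsTo (f : ℝ⟦X⟧) (s v : ℝ) : Prop :=
  (Summable fun k => ‖coeff k f * s ^ k‖) ∧ ∑' k, coeff k f * s ^ k = v

namespace EvalsTo

variable {f g : ℝ⟦X⟧} {s v w : ℝ}

theorem hasSum (h : EvalsTo f s v) : HasSum (fun k => coeff k f * s ^ k) v :=
  h.2 ▸ h.1.of_norm.hasSum

theorem mul (hf : EvalsTo f s v) (hg : EvalsTo g s w) : EvalsTo (f * g) s (v * w) := by
  have key : (fun k => coeff k (f * g) * s ^ k) = fun k =>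
      ∑ ij ∈ antidiagonal k, (coeff ij.1 f * s ^ ij.1) * (coeff ij.2 g * s ^ ij.2) := by
    funext k
    rw [coeff_mul, sum_mul]
    refine sum_congr rfl fun ij hij => ?_
    rw [← mem_antidiagonal.1 hij, pow_add]
    ring
  constructor
  · have := summable_norm_sum_mul_antidiagonal_of_summable_norm hf.1 hg.1
    exact (congrArg (fun u : ℕ → ℝ => Summable fun k => ‖u k‖) key).mpr this
  · rw [key, ← tsum_mul_tsum_eq_tsum_sum_antidiagonal_of_summable_norm hf.1 hg.1, hf.2, hg.2]

theorem of_finite_support (n : ℕ) (hn : ∀ k, k ∉ range n → coeff k f = 0) :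
    EvalsTo f s (∑ k ∈ range n, coeff k f * s ^ k) :=
  ⟨summable_of_ne_finset_zero (s := range n) fun k hk => by simp [hn k hk],
    tsum_eq_sum fun k hk => by simp [hn k hk]⟩

theorem coe_polynomial (p : Polynomial ℝ) (s : ℝ) : EvalsTo (p : ℝ⟦X⟧) s (p.eval s) := by
  have := of_finite_support (f := (p : ℝ⟦X⟧)) (s := s) (p.natDegree + 1) fun k hk => by
    rw [Polynomial.coeff_coe]
    exact Polynomial.coeff_eq_zero_of_natDegree_lt (by simpa using hk)
  simpa [Polynomial.eval_eq_sum_range] using this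

theorem pow (hf : EvalsTo f s v) (n : ℕ) : EvalsTo (f ^ n) s (v ^ n) := by
  induction n with
  | zero => simpa using coe_polynomial 1 s
  | succ n ih => simpa [pow_succ] using ih.mul hf

theorem mk_one (hs : |s| < 1) : EvalsTo (mk 1) s (1 - s)⁻¹ := by
  constructor
  · simpa using summable_geometric_of_lt_one (abs_nonneg s) hs
  · simpa using tsum_geometric_of_abs_lt_one hs

end EvalsTo

theorem coeff_mul_coeff_le {f g : ℝ⟦X⟧} (hf : ∀ k, 0 ≤ coeff k f) (hg : ∀ k, 0 ≤ coeff k g)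
    (i j : ℕ) : coeff i f * coeff j g ≤ coeff (i + j) (f * g) := by
  rw [coeff_mul]
  exact single_le_sum (f := fun ij : ℕ × ℕ => coeff ij.1 f * coeff ij.2 g)
    (fun ij _ => mul_nonneg (hf _) (hg _)) (mem_antidiagonal.2 (rfl : (i, j).1 + (i, j).2 = i + j))

theorem coeff_mul_nonneg {f g : ℝ⟦X⟧} (hf : ∀ k, 0 ≤ coeff k f) (hg : ∀ k, 0 ≤ coeff k g)
    (k : ℕ) : 0 ≤ coeff k (f * g) := by
  rw [coeff_mul]
  exact sum_nonneg fun ij _ => mul_nonneg (hf _) (hg _)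

theorem coeff_pow_nonneg {f : ℝ⟦X⟧} (hf : ∀ k, 0 ≤ coeff k f) (n k : ℕ) :
    0 ≤ coeff k (f ^ n) := by
  induction n generalizing k with
  | zero => rw [pow_zero, coeff_one]; positivity
  | succ n ih => rw [pow_succ]; exact coeff_mul_nonneg ih hf k

theorem one_le_coeff_pow {f : ℝ⟦X⟧} (hf : ∀ k, 1 ≤ coeff k f) {n : ℕ} (hn : n ≠ 0) (k : ℕ) :
    1 ≤ coeff k (f ^ n) := by
  have h0 : ∀ k, 0 ≤ coeff k f := fun k => zero_le_one.trans (hf k)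
  obtain ⟨m, rfl⟩ := Nat.exists_eq_succ_of_ne_zero hn
  have h1 : 1 ≤ coeff 0 (f ^ m) := by
    simpa using one_le_pow₀ (hf 0) (n := m)
  rw [Nat.succ_eq_add_one, pow_succ]
  calc (1 : ℝ) ≤ coeff 0 (f ^ m) * coeff k f := one_le_mul_of_one_le_of_one_le h1 (hf k)
    _ ≤ _ := by simpa using coeff_mul_coeff_le (coeff_pow_nonneg h0 m) h0 0 k

theorem HasDerivAt.exists_lt_left {f : ℝ → ℝ} {x f' a : ℝ} (hf : HasDerivAt f f' x) (hf' : 0 < f')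
    (ha : a < x) : ∃ y ∈ Set.Ioo a x, f y < f x := by
  have h := (hasDerivAt_iff_tendsto_slope.1 hf).mono_left (nhdsLT_le_nhdsNE x)
  obtain ⟨y, hy, hyx⟩ := ((h.eventually (lt_mem_nhds hf')).and (Ioo_mem_nhdsLT ha)).exists
  refine ⟨y, hyx, ?_⟩
  rw [slope_def_field, div_pos_iff] at hy
  rcases hy with hy | hy <;> linarith [hyx.2]

theorem HasDerivAt.exists_lt_right {f : ℝ → ℝ} {x f' b : ℝ} (hf : HasDerivAt f f' x)
    (hf' : f' < 0) (hb : x < b) : ∃ y ∈ Set.Ioo x b, f y < f x := by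
  have h := (hasDerivAt_iff_tendsto_slope.1 hf).mono_left (nhdsGT_le_nhdsNE x)
  obtain ⟨y, hy, hyx⟩ := ((h.eventually (gt_mem_nhds hf')).and (Ioo_mem_nhdsGT hb)).exists
  refine ⟨y, hyx, ?_⟩
  rw [slope_def_field, div_neg_iff] at hy
  rcases hy with hy | hy <;> linarith [hyx.1]

theorem le_of_pow_le_add_pow {A B B₁ B₂ : ℝ} (hB : 0 ≤ B) (hB₁ : 0 ≤ B₁) (hB₂ : 0 ≤ B₂)
    (h₁ : B₁ < A) (h₂ : B₂ < A) (h : ∀ j : ℕ, A ^ j ≤ B₁ ^ j + B₂ ^ j + 2 * j * B ^ j) :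
    A ≤ B := by
  by_contra! hBA
  have hA : 0 < A := hB₁.trans_lt h₁
  have t₁ := tendsto_pow_atTop_nhds_zero_of_lt_one (div_nonneg hB₁ hA.le) ((div_lt_one hA).2 h₁)
  have t₂ := tendsto_pow_atTop_nhds_zero_of_lt_one (div_nonneg hB₂ hA.le) ((div_lt_one hA).2 h₂)
  have t₃ := (tendsto_self_mul_const_pow_of_lt_one (div_nonneg hB hA.le)
    ((div_lt_one hA).2 hBA)).const_mul 2
  have t := (t₁.add t₂).add t₃
  have : (1 : ℝ) ≤ 0 + 0 + 2 * 0 := by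
    refine ge_of_tendsto' t fun j => ?_
    have hj := div_le_div_of_nonneg_right (h j) (pow_pos hA j).le
    rw [div_self (pow_pos hA j).ne'] at hj
    refine hj.trans_eq ?_
    simp only [div_pow]
    ring
  norm_num at this

/-- At a critical point `r`, the value `G r / r ^ d` is at most any exponential bound `L` for the
coefficients of `X ^ (d * n)` in `p ^ n`. -/
theorem le_of_coeff_pow_le {p : ℝ⟦X⟧} (hp : ∀ k, 1 ≤ coeff k p) {G : ℝ → ℝ}
    (hG : ∀ s ∈ Set.Ioo (0 : ℝ) 1, EvalsTo p s (G s)) {d : ℕ} (hd : 1 ≤ d) {r : ℝ}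
    (hr : r ∈ Set.Ioo (0 : ℝ) 1) (hcrit : HasDerivAt (fun s => G s / s ^ d) 0 r) {L : ℝ}
    (hL : 0 < L) (hc : ∀ n, coeff (d * n) (p ^ n) ≤ L ^ n) : G r / r ^ d ≤ L := by
  have h0 : ∀ k, 0 ≤ coeff k p := fun k => zero_le_one.trans (hp k)
  have hGpos : ∀ s ∈ Set.Ioo (0 : ℝ) 1, 0 < G s := fun s hs =>
    lt_of_lt_of_le (by have := hs.1; have := hp 0; positivity)
      (le_hasSum (hG s hs).hasSum 0 fun k _ =>
        mul_nonneg (h0 k) (pow_nonneg hs.1.le k))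
  set φ : ℝ → ℝ := fun s => G s / s ^ d with hφ
  have hφpos : ∀ s ∈ Set.Ioo (0 : ℝ) 1, 0 < φ s := fun s hs =>
    div_pos (hGpos s hs) (pow_pos hs.1 d)
  have hr0 := hr.1
  suffices key : ∀ M : ℕ, 1 ≤ M → φ r ^ M * r ≤ L ^ (M + 1) by
    change φ r ≤ L
    by_contra! hlt
    obtain ⟨M, hM⟩ := pow_unbounded_of_one_lt (L / r) ((one_lt_div hL).2 hlt)
    have h2 : (φ r / L) ^ M ≤ (φ r / L) ^ (M + 1) :=
      pow_le_pow_right₀ ((one_lt_div hL).2 hlt).le (Nat.le_succ M)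
    have h3 := key (M + 1) (Nat.le_add_left 1 M)
    have h4 : (φ r / L) ^ (M + 1) ≤ L / r := by
      rw [div_pow, div_le_div_iff₀ (by positivity) hr0]
      calc _ ≤ _ := h3
        _ = _ := by ring
    linarith
  intro M hM
  have hφr := hφpos r hr
  obtain ⟨s₁, hs₁, hlt₁⟩ := ((hcrit.pow M).mul (hasDerivAt_id r)).exists_lt_left
    (by simpa using pow_pos hφr M) hr0
  obtain ⟨s₂, hs₂, hlt₂⟩ := ((hcrit.pow M).div (hasDerivAt_id r) hr0.ne').exists_lt_right
    (by simpa [neg_div] using div_pos (pow_pos hφr M) (pow_pos hr0 2)) hr.2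
  have hs₁' : s₁ ∈ Set.Ioo (0 : ℝ) 1 := ⟨hs₁.1, hs₁.2.trans hr.2⟩
  have hs₂' : s₂ ∈ Set.Ioo (0 : ℝ) 1 := ⟨hr0.trans hs₂.1, hs₂.2⟩
  have hs₁0 := hs₁'.1
  have hs₂0 := hs₂'.1
  have hφ₁ := hφpos s₁ hs₁'
  have hφ₂ := hφpos s₂ hs₂'
  replace hlt₁ : φ s₁ ^ M * s₁ < φ r ^ M * r := by simpa using hlt₁
  replace hlt₂ : φ s₂ ^ M / s₂ * r ^ 2 < φ r ^ M * r := by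
    have : φ s₂ ^ M / s₂ < φ r ^ M / r := by simpa using hlt₂
    calc _ < φ r ^ M / r * r ^ 2 := by gcongr
      _ = _ := by field_simp
  refine le_of_pow_le_add_pow (by positivity) (by positivity) (by positivity) hlt₁ hlt₂ fun j => ?_
  set a : ℕ → ℝ := fun k => coeff k (p ^ (M * j)) with ha
  have ha0 : ∀ k, 0 ≤ a k := coeff_pow_nonneg h0 _
  have hdM : 1 ≤ d * M := Nat.mul_pos hd hM
  obtain ⟨e, he⟩ := Nat.exists_eq_add_of_le' hdM
  set I := Ico (e * j) ((e + 2) * j) with hI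
  have hmid : ∀ k ∈ I, a k * r ^ k ≤ (L ^ (M + 1)) ^ j * r ^ (e * j) := by
    intro k hk
    rw [hI, mem_Ico] at hk
    have hj : j ≠ 0 := by rintro rfl; simp at hk
    have hle : k ≤ d * (M * j + j) := by
      have : (e + 2) * j = d * (M * j) + j := by rw [← mul_assoc, he]; ring
      nlinarith
    refine mul_le_mul ?_ (pow_le_pow_of_le_one hr0.le hr.2.le hk.1) (by positivity) (by positivity)
    obtain ⟨i, hi⟩ := Nat.exists_eq_add_of_le hle
    calc a k = a k * 1 := (mul_one _).symm
      _ ≤ a k * coeff i (p ^ j) := by gcongr; exacts [ha0 k, one_le_coeff_pow hp hj i]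
      _ ≤ coeff (k + i) (p ^ (M * j) * p ^ j) :=
        coeff_mul_coeff_le ha0 (coeff_pow_nonneg h0 _) k i
      _ = coeff (d * (M * j + j)) (p ^ (M * j + j)) := by rw [← hi, pow_add]
      _ ≤ L ^ (M * j + j) := hc _
      _ = _ := by rw [← pow_mul]; ring
  have hS := ((hG r hr).pow (M * j)).hasSum
  have hS₁ := ((hG s₁ hs₁').pow (M * j)).hasSum.mul_right ((r / s₁) ^ (e * j))
  have hS₂ := ((hG s₂ hs₂').pow (M * j)).hasSum.mul_right ((r / s₂) ^ ((e + 2) * j))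
  have hS₃ : HasSum (fun k => if k ∈ I then (L ^ (M + 1)) ^ j * r ^ (e * j) else 0) _ :=
    hasSum_sum_of_ne_finset_zero (s := I) fun k hk => if_neg hk
  have hle := hasSum_le (fun k => ?_) hS ((hS₁.add hS₂).add hS₃)
  · rw [sum_congr rfl fun k hk => if_pos hk, sum_const, hI, Nat.card_Ico,
      ← Nat.sub_mul, Nat.add_sub_cancel_left, nsmul_eq_mul] at hle
    have hrew : ∀ s, s ≠ 0 → G s ^ (M * j) = (φ s ^ M) ^ j * s ^ ((e + 1) * j) := by
      intro s hs
      calc G s ^ (M * j) = (φ s * s ^ d) ^ (M * j) := by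
            rw [hφ, div_mul_cancel₀ _ (pow_ne_zero d hs)]
        _ = (φ s ^ M) ^ j * s ^ (d * M * j) := by ring
        _ = _ := by rw [he]
    rw [hrew r hr0.ne', hrew s₁ hs₁0.ne', hrew s₂ hs₂0.ne'] at hle
    have hpos : 0 < r ^ (e * j) := by positivity
    refine le_of_mul_le_mul_right ?_ hpos
    have e₁ : s₁ ^ (e * j) * (r / s₁) ^ (e * j) = r ^ (e * j) := by
      rw [← mul_pow, mul_div_cancel₀ _ hs₁0.ne']
    have e₂ : s₂ ^ ((e + 1) * j) * (r / s₂) ^ ((e + 2) * j) =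
        (r ^ 2 / s₂) ^ j * r ^ (e * j) := by
      calc _ = (s₂ * (r / s₂)) ^ ((e + 1) * j) * (r / s₂) ^ j := by rw [mul_pow]; ring
        _ = r ^ ((e + 1) * j) * (r / s₂) ^ j := by rw [mul_div_cancel₀ _ hs₂0.ne']
        _ = _ := by ring
    refine le_trans (le_of_eq ?_) (hle.trans (le_of_eq ?_))
    · ring
    · rw [mul_assoc _ (s₂ ^ _), e₂]
      calc _ = (φ s₁ ^ M) ^ j * s₁ ^ j * (s₁ ^ (e * j) * (r / s₁) ^ (e * j)) +
            (φ s₂ ^ M) ^ j * ((r ^ 2 / s₂) ^ j * r ^ (e * j)) +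
            (2 * j : ℕ) * ((L ^ (M + 1)) ^ j * r ^ (e * j)) := by ring
        _ = _ := by rw [e₁]; push_cast; ring
  · change a k * r ^ k ≤ a k * s₁ ^ k * (r / s₁) ^ (e * j) +
      a k * s₂ ^ k * (r / s₂) ^ ((e + 2) * j) + _
    have hak := ha0 k
    have n₁ : 0 ≤ a k * s₁ ^ k * (r / s₁) ^ (e * j) := by positivity
    have n₂ : 0 ≤ a k * s₂ ^ k * (r / s₂) ^ ((e + 2) * j) := by positivity
    have n₃ : 0 ≤ (L ^ (M + 1)) ^ j * r ^ (e * j) := by positivity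
    have hre : ∀ s, s ≠ 0 → a k * r ^ k = a k * s ^ k * (r / s) ^ k := by
      intro s hs
      rw [div_pow]
      field_simp
    by_cases hk : k ∈ I
    · rw [if_pos hk]
      linarith [hmid k hk]
    · rw [if_neg hk, add_zero]
      rw [hI, mem_Ico, not_and_or, not_le, not_lt] at hk
      rcases hk with hk | hk
      · have : a k * r ^ k ≤ a k * s₁ ^ k * (r / s₁) ^ (e * j) := by
          rw [hre s₁ hs₁0.ne']
          gcongr
          exact (one_le_div hs₁0).2 hs₁.2.le
        linarith
      · have : a k * r ^ k ≤ a k * s₂ ^ k * (r / s₂) ^ ((e + 2) * j) := by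
          rw [hre s₂ hs₂0.ne']
          exact mul_le_mul_of_nonneg_left
            (pow_le_pow_of_le_one (by positivity) ((div_le_one hs₂0).2 hs₂.1.le) hk)
            (by positivity)
        linarith

theorem tendsto_root_coeff_pow {p : ℝ⟦X⟧} (hp : ∀ k, 1 ≤ coeff k p) {G : ℝ → ℝ}
    (hG : ∀ s ∈ Set.Ioo (0 : ℝ) 1, EvalsTo p s (G s)) {d : ℕ} (hd : 1 ≤ d) {r : ℝ}
    (hr : r ∈ Set.Ioo (0 : ℝ) 1) (hcrit : HasDerivAt (fun s => G s / s ^ d) 0 r) :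
    Tendsto (fun n : ℕ => coeff (d * n) (p ^ n) ^ (1 / (n : ℝ))) atTop (𝓝 (G r / r ^ d)) := by
  have h0 : ∀ k, 0 ≤ coeff k p := fun k => zero_le_one.trans (hp k)
  have hr0 := hr.1
  set c : ℕ → ℝ := fun n => coeff (d * n) (p ^ n) with hcdef
  have hc1 : ∀ n, 1 ≤ c n := by
    intro n
    rcases eq_or_ne n 0 with rfl | hn
    · simp [hcdef]
    · exact one_le_coeff_pow hp hn _
  have hcpos : ∀ n, 0 < c n := fun n => zero_lt_one.trans_le (hc1 n)
  have hupper : ∀ n, c n ≤ (G r / r ^ d) ^ n := by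
    intro n
    rw [div_pow, ← pow_mul, le_div_iff₀ (by positivity)]
    exact le_hasSum ((hG r hr).pow n).hasSum (d * n) fun k _ =>
      mul_nonneg (coeff_pow_nonneg h0 n k) (pow_nonneg hr0.le k)
  have hφ1 : 1 ≤ G r / r ^ d := by simpa using (hc1 1).trans (hupper 1)
  have hφ : 0 < G r / r ^ d := zero_lt_one.trans_le hφ1
  have hsub : Subadditive fun n => -Real.log (c n) := by
    intro m n
    rw [← neg_add, neg_le_neg_iff, ← Real.log_mul (hcpos m).ne' (hcpos n).ne']
    refine Real.log_le_log (mul_pos (hcpos m) (hcpos n)) ?_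
    have := coeff_mul_coeff_le (coeff_pow_nonneg h0 m) (coeff_pow_nonneg h0 n) (d * m) (d * n)
    rwa [← pow_add, ← mul_add] at this
  have hlog : ∀ n, Real.log (c n) ≤ n * Real.log (G r / r ^ d) := fun n => by
    rw [← Real.log_pow]
    exact Real.log_le_log (hcpos n) (hupper n)
  have hbdd : BddBelow (Set.range fun n : ℕ => -Real.log (c n) / n) := by
    refine ⟨-Real.log (G r / r ^ d), ?_⟩
    rintro _ ⟨n, rfl⟩
    rcases eq_or_ne n 0 with rfl | hn
    · simpa using Real.log_nonneg hφ1
    · have : (0 : ℝ) < n := by positivity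
      rw [le_div_iff₀ this]
      linarith [hlog n]
  have hlim := hsub.tendsto_lim hbdd
  have hexp : Tendsto (fun n : ℕ => c n ^ (1 / (n : ℝ))) atTop (𝓝 (Real.exp (-hsub.lim))) := by
    refine ((Real.continuous_exp.tendsto _).comp hlim.neg).congr fun n => ?_
    rw [Real.rpow_def_of_pos (hcpos n)]
    simp only [Function.comp]
    congr 1
    ring
  convert hexp using 2
  refine le_antisymm (le_of_coeff_pow_le hp hG hd hr hcrit (Real.exp_pos _) fun n => ?_) ?_
  · rcases eq_or_ne n 0 with rfl | hn
    · simp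
    · have h1 := hsub.lim_le_div hbdd hn
      have : (0 : ℝ) < n := by positivity
      rw [le_div_iff₀ this] at h1
      rw [← Real.exp_nat_mul, ← Real.log_le_iff_le_exp (hcpos n)]
      linarith
  · refine le_of_tendsto hexp (eventually_atTop.2 ⟨1, fun n hn => ?_⟩)
    refine (Real.rpow_le_rpow (hcpos n).le (hupper n) (by positivity)).trans_eq ?_
    rw [one_div, Real.pow_rpow_inv_natCast hφ.le (by lia)]

theorem root_mem_Ioo_of_cubic {x : ℝ}
    (hx : 108 * x ^ 3 - 2359989 * x ^ 2 + 138304 * x - 2048 = 0) : 21851 < x ∧ x < 21852 := by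
  have hq : 0 < 2359989 * x ^ 2 - 138304 * x + 2048 := by
    nlinarith [sq_nonneg (2359989 * x - 69152)]
  have hx0 : 0 < x := by
    by_contra! h
    nlinarith [pow_nonneg (neg_nonneg.2 h) 3]
  have hx1 : 1 / 2 < x := by
    by_contra! h
    have : x ^ 3 ≤ (1 / 2) * x ^ 2 := by nlinarith [sq_nonneg x]
    nlinarith [sq_nonneg (2359989 * x - 69152), pow_le_pow_left₀ hx0.le h 3]
  have hx2 : 2000 < x := by nlinarith
  constructor
  · by_contra! h
    nlinarith [mul_nonneg (sq_nonneg x) (sub_nonneg.2 h)]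
  · by_contra! h
    nlinarith [mul_nonneg (sq_nonneg x) (sub_nonneg.2 h)]

theorem cubic_root_unique {x y : ℝ}
    (hx : 108 * x ^ 3 - 2359989 * x ^ 2 + 138304 * x - 2048 = 0)
    (hy : 108 * y ^ 3 - 2359989 * y ^ 2 + 138304 * y - 2048 = 0) : x = y := by
  obtain ⟨hx1, hx2⟩ := root_mem_Ioo_of_cubic hx
  obtain ⟨hy1, hy2⟩ := root_mem_Ioo_of_cubic hy
  have : (x - y) * (108 * (x ^ 2 + x * y + y ^ 2) - 2359989 * (x + y) + 138304) = 0 := by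
    linear_combination hx - hy
  rcases mul_eq_zero.1 this with h | h
  · linarith
  · nlinarith

/-- The growth function whose minimum on `(0, 1)` governs the growth of the coefficients of `π`. -/
noncomputable def growth (s : ℝ) : ℝ :=
  4 * (1 + s) ^ 2 * (2 * s ^ 4 + 6 * s ^ 3 + 9 * s ^ 2 + 6 * s + 2) ^ 2 * ((1 - s)⁻¹) ^ 4

theorem exists_critical_point_growth : ∃ r ∈ Set.Ioo (0 : ℝ) 1,
    6 * (r ^ 2 + 1) ^ 3 - 6 * (r ^ 2 + 1) ^ 2 * r - 73 * (r ^ 2 + 1) * r ^ 2 - 78 * r ^ 3 = 0 := by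
  have hc : ContinuousOn (fun r : ℝ => 6 * (r ^ 2 + 1) ^ 3 - 6 * (r ^ 2 + 1) ^ 2 * r -
      73 * (r ^ 2 + 1) * r ^ 2 - 78 * r ^ 3) (Set.Icc 0 1) := by fun_prop
  exact intermediate_value_Ioo' zero_le_one hc (by norm_num)

theorem hasDerivAt_growth_div {r : ℝ} (hr : r ∈ Set.Ioo (0 : ℝ) 1)
    (hcrit : 6 * (r ^ 2 + 1) ^ 3 - 6 * (r ^ 2 + 1) ^ 2 * r - 73 * (r ^ 2 + 1) * r ^ 2 -
      78 * r ^ 3 = 0) :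
    HasDerivAt (fun s => growth s / s ^ 3) 0 r := by
  have h0 : r ≠ 0 := hr.1.ne'
  have h1 : 1 - r ≠ 0 := (sub_pos.2 hr.2).ne'
  have hid := hasDerivAt_id r
  have hA := (((hid.const_add 1).pow 2).const_mul 4)
  have hP := (((((hid.pow 4).const_mul 2).add ((hid.pow 3).const_mul 6)).add
    ((hid.pow 2).const_mul 9)).add (hid.const_mul 6)).add_const 2
  have hB := ((hid.const_sub 1).inv h1).pow 4
  have := (((hA.mul (hP.pow 2)).mul hB).div (hid.pow 3) (pow_ne_zero 3 h0))
  refine this.congr_deriv ?_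
  simp only [id, Pi.pow_apply, Pi.mul_apply, Pi.add_apply, Pi.inv_apply]
  norm_num
  field_simp
  left
  linear_combination (-4 * r ^ 2 * (1 + r) *
    (2 * r ^ 4 + 6 * r ^ 3 + 9 * r ^ 2 + 6 * r + 2)) * hcrit

theorem growth_div_root {r : ℝ} (hr : r ∈ Set.Ioo (0 : ℝ) 1)
    (hcrit : 6 * (r ^ 2 + 1) ^ 3 - 6 * (r ^ 2 + 1) ^ 2 * r - 73 * (r ^ 2 + 1) * r ^ 2 -
      78 * r ^ 3 = 0) :
    108 * (growth r / r ^ 3) ^ 3 - 2359989 * (growth r / r ^ 3) ^ 2 +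
      138304 * (growth r / r ^ 3) - 2048 = 0 := by
  have h0 : r ≠ 0 := hr.1.ne'
  have h1 : 1 - r ≠ 0 := (sub_pos.2 hr.2).ne'
  obtain ⟨w, hw⟩ : ∃ w, w = (r ^ 2 + 1) / r := ⟨_, rfl⟩
  have hrw : r ^ 2 + 1 = w * r := by rw [hw]; field_simp
  have hw2 : w - 2 ≠ 0 := by
    have : w - 2 = (1 - r) ^ 2 / r := by rw [hw]; field_simp; ring
    rw [this]
    positivity
  have hq : 6 * w ^ 3 - 6 * w ^ 2 - 73 * w - 78 = 0 := by
    have : r ^ 3 * (6 * w ^ 3 - 6 * w ^ 2 - 73 * w - 78) = 0 := by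
      rw [hrw] at hcrit
      linear_combination hcrit
    simpa [h0] using this
  have hN : growth r / r ^ 3 = 6843 / 4 + 11929 / 6 * w + 1163 / 2 * w ^ 2 := by
    have e1 : growth r / r ^ 3 = 4 * (w + 2) * (2 * w ^ 2 + 6 * w + 5) ^ 2 / (w - 2) ^ 2 := by
      have e2 : (w - 2) * r = (1 - r) ^ 2 := by linear_combination -hrw
      have e3 : (w + 2) * r = (1 + r) ^ 2 := by linear_combination -hrw
      have e4 : (2 * w ^ 2 + 6 * w + 5) * r ^ 2 =
          2 * r ^ 4 + 6 * r ^ 3 + 9 * r ^ 2 + 6 * r + 2 := by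
        linear_combination (-2 * (r ^ 2 + 1 + w * r) - 6 * r) * hrw
      rw [growth, ← e3, ← e4, inv_pow, show (1 - r) ^ 4 = ((1 - r) ^ 2) ^ 2 by ring, ← e2]
      field_simp
    rw [e1, div_eq_iff (pow_ne_zero 2 hw2)]
    linear_combination (511 / 6 - 875 / 12 * w + 8 / 3 * w ^ 2) * hq
  rw [hN]
  linear_combination (1958747162051 / 24 + 842098944717 / 8 * w + 39842625033 * w ^ 2 +
    14157339723 / 4 * w ^ 3) * hq

/-- The generating series whose powers carry the coefficients of `π`. -/
noncomputable def growthSeries : ℝ⟦X⟧ :=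
  C 4 * (1 + X) ^ 2 * (C 2 * X ^ 4 + C 6 * X ^ 3 + C 9 * X ^ 2 + C 6 * X + C 2) ^ 2 *
    PowerSeries.mk 1 ^ 4

theorem evalsTo_growthSeries {s : ℝ} (hs : s ∈ Set.Ioo (0 : ℝ) 1) :
    EvalsTo growthSeries s (growth s) := by
  have h := EvalsTo.coe_polynomial (Polynomial.C 4 * (1 + Polynomial.X) ^ 2 *
    (Polynomial.C 2 * Polynomial.X ^ 4 + Polynomial.C 6 * Polynomial.X ^ 3 +
      Polynomial.C 9 * Polynomial.X ^ 2 + Polynomial.C 6 * Polynomial.X + Polynomial.C 2) ^ 2) s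
  have := h.mul ((EvalsTo.mk_one (abs_lt.2 ⟨by linarith [hs.1], hs.2⟩)).pow 4)
  simpa only [growthSeries, growth, Polynomial.coe_mul, Polynomial.coe_add, Polynomial.coe_pow,
    Polynomial.coe_X, Polynomial.coe_C, Polynomial.coe_one, Polynomial.eval_mul, Polynomial.eval_add,
    Polynomial.eval_pow, Polynomial.eval_X, Polynomial.eval_C, Polynomial.eval_one] using this

theorem one_le_coeff_growthSeries (k : ℕ) : 1 ≤ coeff k growthSeries := by
  have hX : ∀ k, 0 ≤ coeff k (1 + X : ℝ⟦X⟧) := fun k => by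
    simp only [map_add, coeff_one, coeff_X]
    positivity
  have hP : ∀ k, 0 ≤ coeff k
      (C 2 * X ^ 4 + C 6 * X ^ 3 + C 9 * X ^ 2 + C 6 * X + C 2 : ℝ⟦X⟧) := fun k => by
    simp only [map_add, coeff_C_mul, coeff_X_pow, coeff_X, coeff_C]
    positivity
  have hC : ∀ k, 0 ≤ coeff k (C 4 : ℝ⟦X⟧) := fun k => by
    rw [coeff_C]
    positivity
  have hS : ∀ k, 0 ≤ coeff k (PowerSeries.mk 1 : ℝ⟦X⟧) := fun k => by simp
  have h := coeff_mul_coeff_le (coeff_mul_nonneg (coeff_mul_nonneg (coeff_mul_nonneg hC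
    (coeff_pow_nonneg hX 2)) (coeff_pow_nonneg hP 2)) (coeff_pow_nonneg hS 3)) hS 0 k
  rw [zero_add, mul_assoc _ (PowerSeries.mk 1 ^ 3), ← pow_succ] at h
  refine le_trans ?_ h
  simp
  norm_num

/-- The numerator of `R n / 5`, as a polynomial in `25 - x ^ 2`. -/
noncomputable def numerator (n : ℕ) : Polynomial ℚ :=
  (25 - Polynomial.X) ^ n * ((25 - Polynomial.X) ^ 2 + 6 * (25 - Polynomial.X) + 25) ^ (2 * n)

/-- The multiple of `π * I / 20` contributed by integrating `(25 - x ^ 2) ^ (j - 3 * n - 1)`. -/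
def piWeight (n j : ℕ) : ℚ :=
  if j ≤ 3 * n then (3 * n - j).centralBinom / 100 ^ (3 * n - j) else 0

theorem coeff_one_sub_X_pow (n k : ℕ) :
    coeff k ((1 - X : ℝ⟦X⟧) ^ n) = (-1) ^ k * n.choose k := by
  have h : ((1 - X : ℝ⟦X⟧) ^ n) = evalNegHom (((1 + Polynomial.X) ^ n : Polynomial ℝ) : ℝ⟦X⟧) := by
    simp [evalNegHom_X, sub_eq_add_neg]
  rw [h, evalNegHom, coeff_rescale, Polynomial.coeff_coe, Polynomial.coeff_one_add_X_pow]

theorem pow_mul_pow_mul_pow_of_mul_eq_one {K : Type*} [CommRing K] {A P S T : K} (h : S * T = 1)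
    (n : ℕ) : (25 * A ^ 2 * S ^ 2) ^ n * (400 * P * S ^ 4) ^ (2 * n) * T ^ (6 * n) =
      10 ^ (6 * n) * (4 * A ^ 2 * P ^ 2 * S ^ 4) ^ n := by
  have h6 : (S * T) ^ 6 = 1 := by rw [h, one_pow]
  rw [pow_mul _ 2 n, pow_mul _ 6 n, pow_mul _ 6 n, ← mul_pow, ← mul_pow, ← mul_pow]
  congr 1
  linear_combination 4000000 * A ^ 2 * P ^ 2 * S ^ 4 * h6

theorem coeff_growthSeries_pow (n : ℕ) :
    coeff (3 * n) (growthSeries ^ n) = (-1) ^ n *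
      ((∑ j ∈ range ((numerator n).natDegree + 1), (numerator n).coeff j * piWeight n j : ℚ) :
        ℝ) := by
  set S : ℝ⟦X⟧ := PowerSeries.mk 1 with hS
  have hST : S * (1 - X) = 1 := mk_one_mul_one_sub_eq_one ℝ
  have hC : ∀ m : ℕ, [m.AtLeastTwo] → (C (OfNat.ofNat m : ℝ) : ℝ⟦X⟧) = OfNat.ofNat m :=
    fun m _ => map_ofNat C m
  set y : ℝ⟦X⟧ := -100 * X * S ^ 2 with hy
  have hy1 : 25 - y = 25 * (1 + X) ^ 2 * S ^ 2 := by
    rw [hy]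
    linear_combination (-25 * (S * (1 - X) + 1)) * hST
  have hy2 : (25 - y) ^ 2 + 6 * (25 - y) + 25 =
      400 * (2 * X ^ 4 + 6 * X ^ 3 + 9 * X ^ 2 + 6 * X + 2) * S ^ 4 := by
    have h2 : S ^ 2 * (1 - X) ^ 2 = 1 := by rw [← mul_pow, hST, one_pow]
    rw [hy1]
    linear_combination (-150 * (1 + X) ^ 2 * S ^ 2 - 25 * (S ^ 2 * (1 - X) ^ 2 + 1)) * h2
  have hD : Polynomial.aeval y (numerator n) * (1 - X) ^ (6 * n) =
      10 ^ (6 * n) * growthSeries ^ n := by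
    simp only [numerator, map_mul, map_pow, map_add, map_sub, Polynomial.aeval_X, map_ofNat]
    rw [hy2, hy1, growthSeries]
    simp only [hC]
    exact pow_mul_pow_mul_pow_of_mul_eq_one hST n
  have hterm : ∀ j, coeff (3 * n) (y ^ j * (1 - X) ^ (6 * n)) =
      (-1) ^ n * 10 ^ (6 * n) * (piWeight n j : ℝ) := by
    intro j
    have h100 : (-100 : ℝ⟦X⟧) ^ j = C ((-100) ^ j) := by
      rw [map_pow, map_neg, hC]
    rw [piWeight]
    split_ifs with hj
    · obtain ⟨m, hm⟩ := Nat.exists_eq_add_of_le hj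
      have h6 : 6 * n = 2 * j + 2 * m := by lia
      have : y ^ j * (1 - X) ^ (6 * n) = C ((-100) ^ j) * (X ^ j * (1 - X) ^ (2 * m)) := by
        rw [hy, ← h100, h6]
        calc _ = (-100) ^ j * (X ^ j * (1 - X) ^ (2 * m)) * (S * (1 - X)) ^ (2 * j) := by
              rw [mul_pow S]
              ring
          _ = _ := by rw [hST]; ring
      have hsign : (-1 : ℝ) ^ n = (-1) ^ (j + m) := by
        rw [← hm, pow_mul]
        norm_num
      rw [this, coeff_C_mul, hm, add_comm j m, coeff_X_pow_mul, coeff_one_sub_X_pow,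
        Nat.add_sub_cancel, h6, hsign, Nat.centralBinom_eq_two_mul_choose]
      push_cast
      rw [← mul_add, pow_mul, neg_pow (100 : ℝ), pow_add, pow_add]
      norm_num
      field_simp
    · rw [hy, show (-100 * X * S ^ 2) ^ j * (1 - X) ^ (6 * n) =
        X ^ j * ((-100) ^ j * S ^ (2 * j) * (1 - X) ^ (6 * n)) by ring, coeff_X_pow_mul',
        if_neg hj]
      simp
  have key := congrArg (coeff (3 * n)) hD
  rw [Polynomial.aeval_eq_sum_range, sum_mul, map_sum,
    show (10 : ℝ⟦X⟧) ^ (6 * n) = C (10 ^ (6 * n)) by rw [map_pow, hC], coeff_C_mul] at key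
  have h10 : (10 : ℝ) ^ (6 * n) ≠ 0 := by positivity
  apply mul_left_cancel₀ h10
  rw [← key]
  push_cast
  rw [mul_sum, mul_sum]
  refine sum_congr rfl fun j _ => ?_
  rw [smul_mul_assoc, show ∀ (q : ℚ) (f : ℝ⟦X⟧), q • f = (q : ℝ) • f from fun q f => by
    ext; simp [Rat.smul_def], map_smul, hterm, smul_eq_mul]
  ring

/-- The field `ℚ(i)` inside `ℂ`. -/
def gaussianRat : Subfield ℂ where
  carrier := {z | ∃ p q : ℚ, z = p + q * Complex.I}
  mul_mem' := by
    rintro _ _ ⟨p, q, rfl⟩ ⟨p', q', rfl⟩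
    refine ⟨p * p' - q * q', p * q' + q * p', ?_⟩
    push_cast
    linear_combination (q * q' : ℂ) * Complex.I_sq
  one_mem' := ⟨1, 0, by simp⟩
  add_mem' := by
    rintro _ _ ⟨p, q, rfl⟩ ⟨p', q', rfl⟩
    exact ⟨p + p', q + q', by push_cast; ring⟩
  zero_mem' := ⟨0, 0, by simp⟩
  neg_mem' := by
    rintro _ ⟨p, q, rfl⟩
    exact ⟨-p, -q, by push_cast; ring⟩
  inv_mem' := by
    rintro _ ⟨p, q, rfl⟩
    refine ⟨p / (p ^ 2 + q ^ 2), -q / (p ^ 2 + q ^ 2), ?_⟩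
    by_cases h : p ^ 2 + q ^ 2 = 0
    · have hp : p = 0 := by nlinarith [sq_nonneg p, sq_nonneg q]
      have hq : q = 0 := by nlinarith [sq_nonneg p, sq_nonneg q]
      simp [hp, hq]
    · refine inv_eq_of_mul_eq_one_right ?_
      have h' : (p : ℂ) ^ 2 + (q : ℂ) ^ 2 ≠ 0 := mod_cast h
      push_cast
      field_simp
      linear_combination (-(q : ℂ) ^ 2) * Complex.I_sq

theorem I_mem_gaussianRat : Complex.I ∈ gaussianRat := ⟨0, 1, by simp⟩

/-- The integral of `(25 - x ^ 2) ^ k` along the segment from `-1 - 2i` to `-1 + 2i`. -/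
noncomputable def segmentIntegral (k : ℤ) : ℂ :=
  ∫ t in (-1 : ℝ)..1, (25 - (-1 + 2 * Complex.I * t) ^ 2) ^ k * (2 * Complex.I)

theorem five_add_segment_ne (t : ℝ) : 5 + (-1 + 2 * Complex.I * t) ≠ 0 := fun h => by
  have := congrArg Complex.re h
  norm_num at this

theorem five_sub_segment_ne (t : ℝ) : 5 - (-1 + 2 * Complex.I * t) ≠ 0 := fun h => by
  have := congrArg Complex.re h
  norm_num at this

theorem segment_ne (t : ℝ) : 25 - (-1 + 2 * Complex.I * t) ^ 2 ≠ 0 := by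
  rw [show 25 - (-1 + 2 * Complex.I * t) ^ 2 =
    (5 + (-1 + 2 * Complex.I * t)) * (5 - (-1 + 2 * Complex.I * t)) by ring]
  exact mul_ne_zero (five_add_segment_ne t) (five_sub_segment_ne t)

theorem continuous_segment_zpow (k : ℤ) :
    Continuous fun t : ℝ => (25 - (-1 + 2 * Complex.I * t) ^ 2) ^ k * (2 * Complex.I) :=
  ((by fun_prop : Continuous fun t : ℝ => 25 - (-1 + 2 * Complex.I * (t : ℂ)) ^ 2).zpow₀ k
    fun t => Or.inl (segment_ne t)).mul continuous_const

theorem hasDerivAt_segment (t : ℝ) :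
    HasDerivAt (fun t : ℝ => -1 + 2 * Complex.I * (t : ℂ)) (2 * Complex.I) t := by
  simpa using ((Complex.ofRealCLM.hasDerivAt (x := t)).const_mul (2 * Complex.I)).const_add (-1)

theorem segmentIntegral_recurrence (k : ℤ) :
    (2 * k + 1) * segmentIntegral k - 50 * k * segmentIntegral (k - 1) ∈ gaussianRat := by
  have hd : ∀ t ∈ Set.uIcc (-1 : ℝ) 1, HasDerivAt
      (fun t : ℝ => (-1 + 2 * Complex.I * t) * (25 - (-1 + 2 * Complex.I * (t : ℂ)) ^ 2) ^ k)
      ((2 * k + 1) * ((25 - (-1 + 2 * Complex.I * t) ^ 2) ^ k * (2 * Complex.I)) -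
        50 * k * ((25 - (-1 + 2 * Complex.I * t) ^ 2) ^ (k - 1) * (2 * Complex.I))) t := by
    intro t _
    have h1 := hasDerivAt_segment t
    have h2 := (hasDerivAt_zpow k _ (Or.inl (segment_ne t))).comp t ((h1.pow 2).const_sub 25)
    refine (h1.mul h2).congr_deriv ?_
    have h3 : (25 - (-1 + 2 * Complex.I * (t : ℂ)) ^ 2) ^ k =
        (25 - (-1 + 2 * Complex.I * (t : ℂ)) ^ 2) ^ (k - 1) *
          (25 - (-1 + 2 * Complex.I * (t : ℂ)) ^ 2) := by
      rw [← zpow_add_one₀ (segment_ne t), sub_add_cancel]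
    simp only [Function.comp, Pi.pow_apply]
    rw [h3]
    push_cast
    ring
  have hi := fun k =>
    (continuous_segment_zpow k).intervalIntegrable (μ := MeasureTheory.volume) (-1) 1
  have h := intervalIntegral.integral_eq_sub_of_hasDerivAt hd
    (((hi k).const_mul _).sub ((hi (k - 1)).const_mul _))
  rw [intervalIntegral.integral_sub ((hi k).const_mul _) ((hi (k - 1)).const_mul _),
    intervalIntegral.integral_const_mul, intervalIntegral.integral_const_mul] at h
  rw [segmentIntegral, segmentIntegral, h]
  have hI := I_mem_gaussianRat
  have hn : ∀ m : ℕ, (m : ℂ) ∈ gaussianRat := natCast_mem gaussianRat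
  have hx : ∀ s : ℤ, -1 + 2 * Complex.I * ((s : ℝ) : ℂ) ∈ gaussianRat := fun s =>
    add_mem (neg_mem (one_mem _)) (mul_mem (mul_mem (ofNat_mem _ 2) hI) (by simp))
  have hF : ∀ s : ℤ, (-1 + 2 * Complex.I * ((s : ℝ) : ℂ)) *
      (25 - (-1 + 2 * Complex.I * ((s : ℝ) : ℂ)) ^ 2) ^ k ∈ gaussianRat := fun s =>
    mul_mem (hx s) (zpow_mem (sub_mem (ofNat_mem _ 25) (pow_mem (hx s) 2)) k)
  simpa using sub_mem (hF 1) (hF (-1))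

theorem log_one_add_I_div_two_sub :
    Complex.log ((1 + Complex.I) / 2) - Complex.log ((1 - Complex.I) / 2) =
      Complex.I * Real.pi / 2 := by
  have harg : Complex.arg ((1 + Complex.I) / 2) = Real.pi / 4 := by
    have hz : (1 + Complex.I) / 2 = ((√2 / 2 : ℝ) : ℂ) *
        (Complex.cos ((Real.pi / 4 : ℝ) : ℂ) + Complex.sin ((Real.pi / 4 : ℝ) : ℂ) *
          Complex.I) := by
      have h2 : ((√2 : ℝ) : ℂ) ^ 2 = 2 := by
        rw [← Complex.ofReal_pow, Real.sq_sqrt zero_le_two]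
        simp
      rw [← Complex.ofReal_cos, ← Complex.ofReal_sin, Real.cos_pi_div_four, Real.sin_pi_div_four]
      push_cast
      linear_combination (-(1 + Complex.I) / 4) * h2
    rw [hz, Complex.arg_mul_cos_add_sin_mul_I (by positivity)
      ⟨by linarith [Real.pi_pos], by linarith [Real.pi_pos]⟩]
  have hconj : (1 - Complex.I) / 2 = (starRingEnd ℂ) ((1 + Complex.I) / 2) := by
    rw [map_div₀, map_add, map_one, Complex.conj_I, ← sub_eq_add_neg, map_ofNat]
  rw [hconj, Complex.log_conj _ (by rw [harg]; linarith [Real.pi_pos]), Complex.sub_conj,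
    Complex.log_im, harg]
  push_cast
  ring

theorem segmentIntegral_neg_one : segmentIntegral (-1) = Complex.I * Real.pi / 20 := by
  have hd : ∀ t ∈ Set.uIcc (-1 : ℝ) 1, HasDerivAt
      (fun t : ℝ => Complex.log ((5 + (-1 + 2 * Complex.I * t)) /
        (5 - (-1 + 2 * Complex.I * (t : ℂ)))) / 10)
      ((25 - (-1 + 2 * Complex.I * t) ^ 2) ^ (-1 : ℤ) * (2 * Complex.I)) t := by
    intro t ht
    rw [Set.uIcc_of_le (by norm_num), Set.mem_Icc] at ht
    have h1 := hasDerivAt_segment t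
    have hp := five_add_segment_ne t
    have hm := five_sub_segment_ne t
    have hslit : (5 + (-1 + 2 * Complex.I * (t : ℂ))) / (5 - (-1 + 2 * Complex.I * (t : ℂ))) ∈
        Complex.slitPlane := by
      refine Or.inl ?_
      rw [Complex.div_re, ← add_div]
      refine div_pos ?_ (Complex.normSq_pos.2 hm)
      norm_num
      nlinarith
    refine (((h1.const_add 5).div (h1.const_sub 5) hm).clog_real hslit).div_const 10
      |>.congr_deriv ?_
    simp only [Pi.div_apply]
    rw [zpow_neg_one, show 25 - (-1 + 2 * Complex.I * (t : ℂ)) ^ 2 =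
      (5 + (-1 + 2 * Complex.I * t)) * (5 - (-1 + 2 * Complex.I * t)) by ring]
    generalize -1 + 2 * Complex.I * (t : ℂ) = x at hp hm
    field_simp
    ring
  have h := intervalIntegral.integral_eq_sub_of_hasDerivAt hd
    ((continuous_segment_zpow (-1)).intervalIntegrable _ _)
  have e₁ : (5 + (-1 + 2 * Complex.I)) / (5 - (-1 + 2 * Complex.I)) = (1 + Complex.I) / 2 := by
    have := five_sub_segment_ne 1
    rw [Complex.ofReal_one, mul_one] at this
    rw [div_eq_div_iff this two_ne_zero]
    linear_combination 2 * Complex.I_sq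
  have e₂ : (5 + (-1 + 2 * Complex.I * -1)) / (5 - (-1 + 2 * Complex.I * -1)) =
      (1 - Complex.I) / 2 := by
    have := five_sub_segment_ne (-1)
    rw [Complex.ofReal_neg, Complex.ofReal_one] at this
    rw [div_eq_div_iff this two_ne_zero]
    linear_combination 2 * Complex.I_sq
  rw [segmentIntegral, h]
  push_cast
  rw [mul_one, e₁, e₂, ← sub_div, log_one_add_I_div_two_sub]
  ring

theorem segmentIntegral_natCast_mem (k : ℕ) : segmentIntegral k ∈ gaussianRat := by
  have h2k : ∀ k : ℕ, (2 * (k : ℂ) + 1) ≠ 0 := fun k => by norm_cast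
  induction k with
  | zero => simpa using segmentIntegral_recurrence 0
  | succ k ih =>
    have h := segmentIntegral_recurrence (k + 1 : ℕ)
    rw [show ((k + 1 : ℕ) : ℤ) - 1 = k by push_cast; ring] at h
    push_cast at h ⊢
    have := div_mem (add_mem h (mul_mem (mul_mem (ofNat_mem gaussianRat 50)
      (natCast_mem gaussianRat (k + 1))) ih)) (natCast_mem gaussianRat (2 * (k + 1) + 1))
    convert this using 1
    have := h2k (k + 1)
    push_cast at this ⊢
    field_simp
    ring

theorem segmentIntegral_neg_sub_mem (m : ℕ) :
    segmentIntegral (-m - 1) - (m.centralBinom / 100 ^ m : ℚ) * (Complex.I * Real.pi / 20) ∈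
      gaussianRat := by
  induction m with
  | zero => simp [segmentIntegral_neg_one, zero_mem]
  | succ m ih =>
    have h := segmentIntegral_recurrence (-m - 1)
    rw [show -((m + 1 : ℕ) : ℤ) - 1 = -m - 1 - 1 by push_cast; ring]
    have hb : ((m + 1 : ℂ)) * (m + 1).centralBinom = 2 * (2 * m + 1) * m.centralBinom := by
      exact_mod_cast Nat.succ_mul_centralBinom_succ m
    have := div_mem (add_mem h (mul_mem (natCast_mem gaussianRat (2 * m + 1)) ih))
      (natCast_mem gaussianRat (50 * (m + 1)))
    convert this using 1
    have hm : (m + 1 : ℂ) ≠ 0 := by norm_cast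
    have hb' : ((m + 1).centralBinom : ℂ) = 2 * (2 * m + 1) * m.centralBinom / (m + 1) := by
      rw [eq_div_iff hm, ← hb]
      ring
    push_cast
    rw [hb']
    field_simp
    ring

theorem segmentIntegral_sub_piWeight_mem (n j : ℕ) :
    segmentIntegral (j - (3 * n + 1 : ℕ)) - piWeight n j * (Complex.I * Real.pi / 20) ∈
      gaussianRat := by
  rw [piWeight]
  split_ifs with hj
  · obtain ⟨m, hm⟩ := Nat.exists_eq_add_of_le hj
    rw [hm, Nat.add_sub_cancel_left,
      show (j : ℤ) - (j + m + 1 : ℕ) = -m - 1 by push_cast; ring]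
    exact segmentIntegral_neg_sub_mem m
  · obtain ⟨m, rfl⟩ := Nat.exists_eq_add_of_le (Nat.lt_of_not_le hj)
    rw [Nat.succ_eq_add_one, show ((3 * n + 1 + m : ℕ) : ℤ) - (3 * n + 1 : ℕ) = m by
      push_cast; ring]
    simpa using segmentIntegral_natCast_mem m

theorem R_eq_sum (n : ℕ) (t : ℝ) : R n (-1 + 2 * Complex.I * t) * (2 * Complex.I) =
    ∑ j ∈ range ((numerator n).natDegree + 1), 5 * (numerator n).coeff j *
      ((25 - (-1 + 2 * Complex.I * t) ^ 2) ^ ((j : ℤ) - (3 * n + 1 : ℕ)) * (2 * Complex.I)) := by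
  have hne := segment_ne t
  generalize hx : -1 + 2 * Complex.I * (t : ℂ) = x at hne ⊢
  have h := Polynomial.aeval_eq_sum_range (p := numerator n) (25 - x ^ 2)
  simp only [numerator, map_mul, map_pow, map_add, map_sub, Polynomial.aeval_X, map_ofNat,
    sub_sub_cancel] at h
  have hR : R n x = 5 * ((x ^ 2) ^ n * ((x ^ 2) ^ 2 + 6 * x ^ 2 + 25) ^ (2 * n)) /
      (25 - x ^ 2) ^ (3 * n + 1) := by
    rw [R, ← mul_pow]
    congr 1
    · ring
    · congr 1
      ring
  rw [hR, h, mul_sum, sum_div, sum_mul]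
  refine sum_congr rfl fun j _ => ?_
  rw [zpow_sub₀ hne, zpow_natCast, zpow_natCast, Rat.smul_def, numerator]
  ring

theorem In_sub_mem (n : ℕ) :
    In n - ((coeff (3 * n) (growthSeries ^ n) : ℝ) : ℂ) / 4 * Real.pi ∈ gaussianRat := by
  have hint : In n = Complex.I * (-1) ^ (n + 1) *
      ∑ j ∈ range ((numerator n).natDegree + 1), 5 * (numerator n).coeff j *
        segmentIntegral (j - (3 * n + 1 : ℕ)) := by
    rw [In]
    simp only [R_eq_sum]
    rw [intervalIntegral.integral_finsetSum fun j _ =>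
      ((continuous_segment_zpow _).intervalIntegrable _ _).const_mul _]
    simp only [intervalIntegral.integral_const_mul, segmentIntegral]
  have hmem : ∑ j ∈ range ((numerator n).natDegree + 1), 5 * ((numerator n).coeff j : ℂ) *
      (segmentIntegral (j - (3 * n + 1 : ℕ)) - piWeight n j * (Complex.I * Real.pi / 20)) ∈
        gaussianRat :=
    sum_mem fun j _ => mul_mem (mul_mem (ofNat_mem _ 5) (SubfieldClass.ratCast_mem _ _))
      (segmentIntegral_sub_piWeight_mem n j)
  convert mul_mem (mul_mem I_mem_gaussianRat
    (pow_mem (neg_mem (one_mem gaussianRat)) (n + 1))) hmem using 1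
  rw [hint, coeff_growthSeries_pow]
  push_cast
  simp only [mul_sub, sum_sub_distrib]
  have hpull : ∑ j ∈ range ((numerator n).natDegree + 1), 5 * ((numerator n).coeff j : ℂ) *
      (piWeight n j * (Complex.I * Real.pi / 20)) =
      (∑ j ∈ range ((numerator n).natDegree + 1), ((numerator n).coeff j : ℂ) * piWeight n j) *
        (Complex.I * Real.pi / 4) := by
    rw [sum_mul]
    exact sum_congr rfl fun j _ => by ring
  rw [hpull]
  generalize ∑ j ∈ range ((numerator n).natDegree + 1), ((numerator n).coeff j : ℂ) *
    piWeight n j = s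
  rw [pow_succ]
  linear_combination (-((-1) ^ n * s * Real.pi / 4)) * Complex.I_sq

theorem eq_of_In_eq {n : ℕ} {a b : ℚ} (h : In n = a + b * (Real.pi : ℂ)) :
    (b : ℝ) = coeff (3 * n) (growthSeries ^ n) / 4 := by
  obtain ⟨p, q, hpq⟩ := In_sub_mem n
  rw [h] at hpq
  have hc := coeff_growthSeries_pow n
  obtain ⟨c, hc⟩ : ∃ c : ℚ, (c : ℝ) = coeff (3 * n) (growthSeries ^ n) :=
    ⟨(-1) ^ n * ∑ j ∈ range ((numerator n).natDegree + 1), (numerator n).coeff j * piWeight n j,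
      by rw [hc]; push_cast; rfl⟩
  rw [← hc] at hpq ⊢
  have hre := congrArg Complex.re hpq
  have hre' : (a : ℝ) + b * Real.pi - c / 4 * Real.pi = p := by
    have e : ((a : ℂ) + b * Real.pi - ((c : ℝ) : ℂ) / 4 * Real.pi) =
        (((a : ℝ) + b * Real.pi - c / 4 * Real.pi : ℝ) : ℂ) := by push_cast; ring
    rw [e, Complex.ofReal_re] at hre
    rw [hre]
    simp
  by_contra hne
  have hbc : (b : ℝ) - c / 4 ≠ 0 := sub_ne_zero.2 hne
  refine irrational_pi ⟨(p - a) / (b - c / 4), ?_⟩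
  push_cast
  rw [div_eq_iff hbc]
  linear_combination -hre'

/-- **Proposition 2, second part.** If `a_n, b_n` are the (unique) rational numbers with
`I_n = a_n + b_n π`, then `lim_{n→∞} |b_n|^{1/n} = N₃`, the unique real root of
`108N³ - 2359989N² + 138304N - 2048`, which lies in `(21851, 21852)`. -/
theorem Proposition2_second :
    ∃ N₃ : ℝ,
      (108 * N₃ ^ 3 - 2359989 * N₃ ^ 2 + 138304 * N₃ - 2048 = 0) ∧
      (∀ x : ℝ, 108 * x ^ 3 - 2359989 * x ^ 2 + 138304 * x - 2048 = 0 → x = N₃) ∧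
      21851 < N₃ ∧ N₃ < 21852 ∧
      ∀ a b : ℕ → ℚ, (∀ n : ℕ, In n = ((a n : ℂ) + (b n : ℂ) * (Real.pi : ℂ))) →
        Filter.Tendsto (fun n : ℕ => |(b n : ℝ)| ^ (1 / (n : ℝ))) Filter.atTop (nhds N₃) := by
  obtain ⟨r, hr, hcrit⟩ := exists_critical_point_growth
  have hroot := growth_div_root hr hcrit
  obtain ⟨hlow, hhigh⟩ := root_mem_Ioo_of_cubic hroot
  refine ⟨growth r / r ^ 3, hroot, fun x hx => cubic_root_unique hx hroot, hlow, hhigh,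
    fun a b hab => ?_⟩
  have hlim := tendsto_root_coeff_pow one_le_coeff_growthSeries
    (fun s hs => evalsTo_growthSeries hs) (by norm_num : 1 ≤ 3) hr
    (hasDerivAt_growth_div hr hcrit)
  have hquarter : Tendsto (fun n : ℕ => (1 / 4 : ℝ) ^ (1 / (n : ℝ))) atTop (𝓝 1) := by
    simpa using (tendsto_const_nhds (x := (1 / 4 : ℝ))).rpow
      (tendsto_one_div_atTop_nhds_zero_nat (𝕜 := ℝ)) (Or.inl (by norm_num))
  have hmul := hlim.mul hquarter
  rw [mul_one] at hmul
  refine hmul.congr fun n => ?_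
  have hnn : 0 ≤ coeff (3 * n) (growthSeries ^ n) :=
    coeff_pow_nonneg (fun k => zero_le_one.trans (one_le_coeff_growthSeries k)) n _
  rw [eq_of_In_eq (hab n), abs_of_nonneg (by positivity), div_eq_mul_one_div (coeff _ _) 4,
    Real.mul_rpow hnn (by norm_num)]
end
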